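/- (Boundedness of H^r norms in 2D.) Let ν, η > 0, let r ≥ 0 be an integer, let 0 < σ < min(ν, η), let 0 < κ < 2 and let N > 1. Let u₀, b₀ : 𝕋² → ℝ² be smooth divergence-free fields with zero average satisfying ‖u₀‖_{H^j} + ‖b₀‖_{H^j} ≤ C₁ N^j for all integers 0 ≤ j ≤ r, and let (u, b, P) be the unique global smooth solution of the MHD system on 𝕋² with initial datum (u₀, b₀). Set Γ = 1 + ‖u₀‖²_{L²} + ‖b₀‖²_{L²}. Then there is a constant C depending only on σ, κ, r, C₁ such that for all t ≥ 0: (i) ‖u(t,·)‖²_{H^r} + ‖b(t,·)‖²_{H^r} + κν∫₀ᵗ‖∇^{r+1}u(s,·)‖²_{L²}ds + κη∫₀ᵗ‖∇^{r+1}b(s,·)‖²_{L²}ds ≤ N^{2r}·e^{CΓ/σ²}, and (ii) ‖u(t,·)‖²_{H^r} + ‖b(t,·)‖²_{H^r} ≤ N^{2r}·e^{−2σt}·e^{CΓ/σ²}. -/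

import Mathlib

open MeasureTheory Real Set

noncomputable section

/-- Partial derivative of a scalar function on `ℝ^d` in the `i`-th coordinate direction. -/
def pd {d : ℕ} (i : Fin d) (f : (Fin d → ℝ) → ℝ) : (Fin d → ℝ) → ℝ :=
  fun x => fderiv ℝ f x (Pi.single i 1)

/-- Iterated partial derivative along a list of directions. -/
def pdList {d : ℕ} : List (Fin d) → ((Fin d → ℝ) → ℝ) → ((Fin d → ℝ) → ℝ)
  | [], f => f
  | i :: l, f => pd i (pdList l f)

/-- The list of directions associated to a multi-index `α`
(the direction `i` repeated `α i` times). -/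
def mIdxList {d : ℕ} (α : Fin d → ℕ) : List (Fin d) :=
  ((List.finRange d).map fun i => List.replicate (α i) i).flatten

/-- The partial derivative `∂^α f` for a multi-index `α`. -/
def pdM {d : ℕ} (α : Fin d → ℕ) (f : (Fin d → ℝ) → ℝ) : (Fin d → ℝ) → ℝ :=
  pdList (mIdxList α) f

/-- `|∇^m w|²(x) = ∑_{|α| = m} |∂^α w(x)|²` for a vector field `w : ℝ^d → ℝ^k`. -/
def gradSq {d k : ℕ} (m : ℕ) (w : (Fin d → ℝ) → Fin k → ℝ) (x : Fin d → ℝ) : ℝ :=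
  ∑ α ∈ Finset.Nat.antidiagonalTuple d m, ∑ i, pdM α (fun y => w y i) x ^ 2

/-- The fundamental domain `[0,L]^d` of the torus `ℝ^d/(Lℤ)^d`. -/
def box (d : ℕ) (L : ℝ) : Set (Fin d → ℝ) := Set.Icc 0 fun _ => L

/-- Square of the Sobolev `H^r` norm on the torus of period `L`. -/
def HnormSq {d k : ℕ} (L : ℝ) (r : ℕ) (w : (Fin d → ℝ) → Fin k → ℝ) : ℝ :=
  ∑ m ∈ Finset.range (r + 1), ∫ x in box d L, gradSq m w x

/-- The Sobolev `H^r` norm on the torus of period `L`. -/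
def Hnorm {d k : ℕ} (L : ℝ) (r : ℕ) (w : (Fin d → ℝ) → Fin k → ℝ) : ℝ :=
  Real.sqrt (HnormSq L r w)

/-- The `L²` norm on the torus of period `L`. -/
def L2norm {d k : ℕ} (L : ℝ) (w : (Fin d → ℝ) → Fin k → ℝ) : ℝ :=
  Real.sqrt (∫ x in box d L, ∑ i, w x i ^ 2)

/-- The `L^∞` norm of `∇^m w`. -/
def LinfGrad {d k : ℕ} (m : ℕ) (w : (Fin d → ℝ) → Fin k → ℝ) : ℝ :=
  ⨆ x : Fin d → ℝ, Real.sqrt (gradSq m w x)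

/-- The `L^∞` norm of `w`. -/
def Linf {d k : ℕ} (w : (Fin d → ℝ) → Fin k → ℝ) : ℝ := LinfGrad 0 w

/-- `L`-periodicity in each coordinate direction. -/
def Prdc {d : ℕ} {E : Type*} (L : ℝ) (w : (Fin d → ℝ) → E) : Prop :=
  ∀ (x : Fin d → ℝ) (i : Fin d), w (x + Pi.single i L) = w x

/-- Zero average on the torus. -/
def ZeroAvg {d k : ℕ} (L : ℝ) (w : (Fin d → ℝ) → Fin k → ℝ) : Prop :=
  ∀ i, (∫ x in box d L, w x i) = 0

/-- Divergence of a vector field on `ℝ^d`. -/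
def divg {d : ℕ} (w : (Fin d → ℝ) → Fin d → ℝ) (x : Fin d → ℝ) : ℝ :=
  ∑ i, pd i (fun y => w y i) x

/-- A smooth solution of the MHD system with viscosity `ν` and resistivity `η` on the torus
`ℝ^d/(Lℤ)^d`, on the time interval `J` (the equations are imposed at positive times of `J`). -/
structure IsMHD (d : ℕ) (L ν η : ℝ) (J : Set ℝ)
    (u b : ℝ → (Fin d → ℝ) → Fin d → ℝ) (P : ℝ → (Fin d → ℝ) → ℝ) : Prop where
  smooth_u : ContDiffOn ℝ (⊤ : ℕ∞) (fun p : ℝ × (Fin d → ℝ) => u p.1 p.2) (J ×ˢ Set.univ)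
  smooth_b : ContDiffOn ℝ (⊤ : ℕ∞) (fun p : ℝ × (Fin d → ℝ) => b p.1 p.2) (J ×ˢ Set.univ)
  smooth_P : ContDiffOn ℝ (⊤ : ℕ∞) (fun p : ℝ × (Fin d → ℝ) => P p.1 p.2) (J ×ˢ Set.univ)
  periodic_u : ∀ t ∈ J, Prdc L (u t)
  periodic_b : ∀ t ∈ J, Prdc L (b t)
  periodic_P : ∀ t ∈ J, Prdc L (P t)
  div_u : ∀ t ∈ J, ∀ x, divg (u t) x = 0
  div_b : ∀ t ∈ J, ∀ x, divg (b t) x = 0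
  momentum : ∀ t ∈ J, 0 < t → ∀ x i,
    deriv (fun s => u s x i) t + (∑ j, u t x j * pd j (fun y => u t y i) x) + pd i (P t) x
      = ν * (∑ j, pd j (pd j fun y => u t y i) x) + ∑ j, b t x j * pd j (fun y => b t y i) x
  induction_eq : ∀ t ∈ J, 0 < t → ∀ x i,
    deriv (fun s => b s x i) t + (∑ j, u t x j * pd j (fun y => b t y i) x)
      = (∑ j, b t x j * pd j (fun y => u t y i) x)
        + η * (∑ j, pd j (pd j fun y => b t y i) x)

/-- Projection from `ℝ^d` onto the torus `ℝ^d/(Lℤ)^d`. -/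
def torusProj (d : ℕ) (L : ℝ) (x : Fin d → ℝ) : Fin d → AddCircle L :=
  fun i => (x i : AddCircle L)

/-- A magnetic line of the field `b`: the image on the torus of a maximal (hence, since the
relevant fields are smooth and periodic, globally defined) integral curve of `b`. -/
def IsMagLine (d : ℕ) (L : ℝ) (b : (Fin d → ℝ) → Fin d → ℝ)
    (s : Set (Fin d → AddCircle L)) : Prop :=
  ∃ γ : ℝ → Fin d → ℝ, (∀ τ : ℝ, HasDerivAt γ (b (γ τ)) τ) ∧
    s = torusProj d L '' Set.range γ

/-- The families of magnetic lines of `b₁` and `b₂` are topologically equivalent: some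
self-homeomorphism of the torus maps the family of magnetic lines of `b₁` bijectively onto the
family of magnetic lines of `b₂`. -/
def MagLinesEquiv (d : ℕ) (L : ℝ) (b₁ b₂ : (Fin d → ℝ) → Fin d → ℝ) : Prop :=
  ∃ φ : (Fin d → AddCircle L) ≃ₜ (Fin d → AddCircle L),
    ∀ s : Set (Fin d → AddCircle L), IsMagLine d L b₁ s ↔ IsMagLine d L b₂ (φ '' s)

/-- Smooth functions on `ℝ^d` that are `1`-periodic in each coordinate direction. -/
structure SmoothPer {d : ℕ} (f : (Fin d → ℝ) → ℝ) : Prop where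
  smooth : ContDiff ℝ (⊤ : ℕ∞) f
  per : Prdc 1 f

section

variable {d : ℕ}

namespace SmoothPer

variable {f g : (Fin d → ℝ) → ℝ}

theorem differentiable (hf : SmoothPer f) : Differentiable ℝ f :=
  hf.smooth.differentiable (by simp)

theorem continuous (hf : SmoothPer f) : Continuous f := hf.smooth.continuous

theorem zero : SmoothPer (fun _ : Fin d → ℝ => (0 : ℝ)) :=
  ⟨contDiff_const, fun _ _ => rfl⟩

theorem add (hf : SmoothPer f) (hg : SmoothPer g) : SmoothPer (fun x => f x + g x) :=
  ⟨hf.smooth.add hg.smooth, fun x i => by simp only [hf.per x i, hg.per x i]⟩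

theorem sub (hf : SmoothPer f) (hg : SmoothPer g) : SmoothPer (fun x => f x - g x) :=
  ⟨hf.smooth.sub hg.smooth, fun x i => by simp only [hf.per x i, hg.per x i]⟩

theorem mul (hf : SmoothPer f) (hg : SmoothPer g) : SmoothPer (fun x => f x * g x) :=
  ⟨hf.smooth.mul hg.smooth, fun x i => by simp only [hf.per x i, hg.per x i]⟩

theorem const_mul (c : ℝ) (hf : SmoothPer f) : SmoothPer (fun x => c * f x) :=
  ⟨contDiff_const.mul hf.smooth, fun x i => by simp only [hf.per x i]⟩

theorem pow (hf : SmoothPer f) (n : ℕ) : SmoothPer (fun x => f x ^ n) :=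
  ⟨hf.smooth.pow n, fun x i => by simp only [hf.per x i]⟩

theorem sum {ι : Type*} (s : Finset ι) {F : ι → (Fin d → ℝ) → ℝ}
    (hF : ∀ a ∈ s, SmoothPer (F a)) : SmoothPer (fun x => ∑ a ∈ s, F a x) :=
  ⟨ContDiff.sum fun a ha => (hF a ha).smooth,
    fun x i => Finset.sum_congr rfl fun a ha => (hF a ha).per x i⟩

theorem pd (hf : SmoothPer f) (i : Fin d) : SmoothPer (pd i f) := by
  refine ⟨?_, fun x j => ?_⟩
  · have h : ContDiff ℝ (⊤ : ℕ∞) (fderiv ℝ f) := hf.smooth.fderiv_right (by simp)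
    exact h.clm_apply contDiff_const
  · have h : (fun y => f (y + Pi.single j 1)) = f := funext fun y => hf.per y j
    have h2 := fderiv_comp_add_right (𝕜 := ℝ) (f := f) (x := x) (Pi.single j 1)
    rw [h] at h2
    simp only [_root_.pd, h2]

theorem pdList (hf : SmoothPer f) (l : List (Fin d)) : SmoothPer (pdList l f) := by
  induction l with
  | nil => exact hf
  | cons i l ih => exact ih.pd i

end SmoothPer

section PartialDerivatives

variable {f g : (Fin d → ℝ) → ℝ}

theorem pd_add (hf : SmoothPer f) (hg : SmoothPer g) (i : Fin d) :
    pd i (fun x => f x + g x) = fun x => pd i f x + pd i g x := by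
  funext x
  simp only [pd]
  rw [fderiv_fun_add (hf.differentiable x) (hg.differentiable x)]
  rfl

theorem pd_sub (hf : SmoothPer f) (hg : SmoothPer g) (i : Fin d) :
    pd i (fun x => f x - g x) = fun x => pd i f x - pd i g x := by
  funext x
  simp only [pd]
  rw [fderiv_fun_sub (hf.differentiable x) (hg.differentiable x)]
  rfl

theorem pd_mul (hf : SmoothPer f) (hg : SmoothPer g) (i : Fin d) :
    pd i (fun x => f x * g x) = fun x => f x * pd i g x + pd i f x * g x := by
  funext x
  simp only [pd]
  rw [fderiv_fun_mul (hf.differentiable x) (hg.differentiable x)]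
  simp [mul_comm]

theorem pd_const_mul (hf : SmoothPer f) (c : ℝ) (i : Fin d) :
    pd i (fun x => c * f x) = fun x => c * pd i f x := by
  funext x
  simp only [pd]
  rw [fderiv_const_mul (hf.differentiable x)]
  rfl

theorem pd_zero (i : Fin d) : pd i (fun _ => (0 : ℝ)) = fun _ => 0 := by
  funext x
  simp [pd]

theorem pd_sum {ι : Type*} (s : Finset ι) {F : ι → (Fin d → ℝ) → ℝ}
    (hF : ∀ a ∈ s, SmoothPer (F a)) (i : Fin d) :
    pd i (fun x => ∑ a ∈ s, F a x) = fun x => ∑ a ∈ s, pd i (F a) x := by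
  funext x
  simp only [pd]
  rw [fderiv_fun_sum fun a ha => (hF a ha).differentiable x]
  simp

theorem pd_comm (hf : SmoothPer f) (i j : Fin d) : pd i (pd j f) = pd j (pd i f) := by
  have hd : Differentiable ℝ (fderiv ℝ f) :=
    (hf.smooth.fderiv_right (m := (⊤ : ℕ∞)) (by simp)).differentiable (by simp)
  have key : ∀ (k l : Fin d) (x : Fin d → ℝ), pd k (pd l f) x
      = fderiv ℝ (fderiv ℝ f) x (Pi.single k 1) (Pi.single l 1) := by
    intro k l x
    change fderiv ℝ (fun y => fderiv ℝ f y (Pi.single l 1)) x (Pi.single k 1) = _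
    rw [fderiv_clm_apply (hd x) (differentiableAt_const _)]
    simp
  funext x
  rw [key, key]
  have h2 : ((2 : ℕ∞) : WithTop ℕ∞) ≤ ((⊤ : ℕ∞) : WithTop ℕ∞) := WithTop.coe_le_coe.2 le_top
  exact (hf.smooth.contDiffAt.isSymmSndFDerivAt (by simpa using h2)) _ _

theorem pdList_pd (hf : SmoothPer f) (l : List (Fin d)) (i : Fin d) :
    pdList l (pd i f) = pd i (pdList l f) := by
  induction l with
  | nil => rfl
  | cons j l ih => simp only [pdList, ih, pd_comm (hf.pdList l)]

theorem pdList_perm (hf : SmoothPer f) {l m : List (Fin d)} (h : l.Perm m) :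
    pdList l f = pdList m f := by
  induction h with
  | nil => rfl
  | cons i _ ih => simp only [pdList, ih]
  | swap i j l => simp only [pdList, pd_comm (hf.pdList l)]
  | trans _ _ h1 h2 => exact h1.trans h2

theorem pdList_add (hf : SmoothPer f) (hg : SmoothPer g) (l : List (Fin d)) :
    pdList l (fun x => f x + g x) = fun x => pdList l f x + pdList l g x := by
  induction l with
  | nil => rfl
  | cons i l ih => simp only [pdList, ih, pd_add (hf.pdList l) (hg.pdList l)]

theorem pdList_sub (hf : SmoothPer f) (hg : SmoothPer g) (l : List (Fin d)) :
    pdList l (fun x => f x - g x) = fun x => pdList l f x - pdList l g x := by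
  induction l with
  | nil => rfl
  | cons i l ih => simp only [pdList, ih, pd_sub (hf.pdList l) (hg.pdList l)]

theorem pdList_const_mul (hf : SmoothPer f) (c : ℝ) (l : List (Fin d)) :
    pdList l (fun x => c * f x) = fun x => c * pdList l f x := by
  induction l with
  | nil => rfl
  | cons i l ih => simp only [pdList, ih, pd_const_mul (hf.pdList l)]

theorem pdList_zero (l : List (Fin d)) :
    pdList l (fun _ => (0 : ℝ)) = fun _ => 0 := by
  induction l with
  | nil => rfl
  | cons i l ih => simp only [pdList, ih, pd_zero]

theorem pdList_sum {ι : Type*} (s : Finset ι) {F : ι → (Fin d → ℝ) → ℝ}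
    (hF : ∀ a ∈ s, SmoothPer (F a)) (l : List (Fin d)) :
    pdList l (fun x => ∑ a ∈ s, F a x) = fun x => ∑ a ∈ s, pdList l (F a) x := by
  induction l with
  | nil => rfl
  | cons i l ih =>
    simp only [pdList, ih]
    rw [pd_sum s fun a ha => (hF a ha).pdList l]

end PartialDerivatives

section Leibniz

/-- The pairs `(l₁, l₂)` of lists of directions that occur in the Leibniz expansion of `∂_l (f g)`
with at least one derivative falling on `f`. -/
def leibnizPairs : List (Fin d) → List (List (Fin d) × List (Fin d))
  | [] => []
  | i :: l => ([i], l) :: ((leibnizPairs l).map (fun p => (p.1, i :: p.2))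
      ++ (leibnizPairs l).map (fun p => (i :: p.1, p.2)))

theorem length_of_mem_leibnizPairs {l : List (Fin d)} :
    ∀ p ∈ leibnizPairs l, 1 ≤ p.1.length ∧ p.1.length + p.2.length = l.length := by
  induction l with
  | nil => simp [leibnizPairs]
  | cons i l ih =>
    intro p hp
    simp only [leibnizPairs, List.mem_cons, List.mem_append, List.mem_map] at hp
    rcases hp with rfl | ⟨q, hq, rfl⟩ | ⟨q, hq, rfl⟩
    · simp [add_comm]
    · have := ih q hq
      simp only [List.length_cons]
      omega
    · have := ih q hq
      simp only [List.length_cons]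
      omega

theorem SmoothPer.list_sum {ι : Type*} (L : List ι) {F : ι → (Fin d → ℝ) → ℝ}
    (hF : ∀ a, SmoothPer (F a)) : SmoothPer (fun x => (L.map fun a => F a x).sum) := by
  induction L with
  | nil => exact SmoothPer.zero
  | cons a L ih => simpa using (hF a).add ih

theorem pd_list_sum {ι : Type*} (L : List ι) {F : ι → (Fin d → ℝ) → ℝ}
    (hF : ∀ a, SmoothPer (F a)) (i : Fin d) :
    pd i (fun x => (L.map fun a => F a x).sum) = fun x => (L.map fun a => pd i (F a) x).sum := by
  induction L with
  | nil => exact pd_zero i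
  | cons a L ih =>
    have := pd_add (hF a) (SmoothPer.list_sum L hF) i
    simp only [List.map_cons, List.sum_cons, this, ih]

theorem pdList_mul {f g : (Fin d → ℝ) → ℝ} (hf : SmoothPer f) (hg : SmoothPer g)
    (l : List (Fin d)) :
    pdList l (fun x => f x * g x) = fun x => f x * pdList l g x
      + ((leibnizPairs l).map fun p => pdList p.1 f x * pdList p.2 g x).sum := by
  induction l with
  | nil => simp [pdList, leibnizPairs]
  | cons i l ih =>
    have hF : ∀ p : List (Fin d) × List (Fin d),
      SmoothPer (fun x => pdList p.1 f x * pdList p.2 g x) :=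
      fun p => (hf.pdList _).mul (hg.pdList _)
    have h1 := pd_add (hf.mul (hg.pdList l)) (SmoothPer.list_sum (leibnizPairs l) hF) i
    simp only [pdList, ih, h1, pd_mul hf (hg.pdList l), pd_list_sum _ hF,
      pd_mul (hf.pdList _) (hg.pdList _)]
    funext x
    simp only [leibnizPairs, List.map_cons, List.sum_cons, List.map_append, List.sum_append,
      List.map_map, Function.comp_def, pdList, List.sum_map_add]
    ring

end Leibniz

end

section TorusIntegral

variable {d : ℕ} {f g : (Fin d → ℝ) → ℝ}

/-- The integral over the unit torus. -/
def torusInt (f : (Fin d → ℝ) → ℝ) : ℝ := ∫ x in box d 1, f x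

theorem isCompact_box (d : ℕ) (L : ℝ) : IsCompact (box d L) := isCompact_Icc

theorem Continuous.integrableOn_box (hf : Continuous f) : IntegrableOn f (box d 1) :=
  hf.continuousOn.integrableOn_compact (isCompact_box d 1)

theorem torusInt_add (hf : Continuous f) (hg : Continuous g) :
    torusInt (fun x => f x + g x) = torusInt f + torusInt g :=
  integral_add hf.integrableOn_box hg.integrableOn_box

theorem torusInt_sub (hf : Continuous f) (hg : Continuous g) :
    torusInt (fun x => f x - g x) = torusInt f - torusInt g :=
  integral_sub hf.integrableOn_box hg.integrableOn_box

theorem torusInt_const_mul (c : ℝ) (f : (Fin d → ℝ) → ℝ) :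
    torusInt (fun x => c * f x) = c * torusInt f :=
  integral_const_mul c f

theorem torusInt_zero : torusInt (fun _ : Fin d → ℝ => (0 : ℝ)) = 0 := by
  simp [torusInt]

theorem torusInt_sum {ι : Type*} (s : Finset ι) {F : ι → (Fin d → ℝ) → ℝ}
    (hF : ∀ a ∈ s, Continuous (F a)) :
    torusInt (fun x => ∑ a ∈ s, F a x) = ∑ a ∈ s, torusInt (F a) :=
  integral_finsetSum s fun a ha => (hF a ha).integrableOn_box

theorem torusInt_list_sum {ι : Type*} (L : List ι) {F : ι → (Fin d → ℝ) → ℝ}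
    (hF : ∀ a, SmoothPer (F a)) :
    torusInt (fun x => (L.map fun a => F a x).sum) = (L.map fun a => torusInt (F a)).sum := by
  induction L with
  | nil => exact torusInt_zero
  | cons a L ih =>
    simp only [List.map_cons, List.sum_cons, ← ih]
    exact torusInt_add (hF a).continuous (SmoothPer.list_sum L hF).continuous

theorem torusInt_nonneg (h : ∀ x, 0 ≤ f x) : 0 ≤ torusInt f :=
  setIntegral_nonneg_ae measurableSet_Icc (Filter.Eventually.of_forall fun x _ => h x)

/-- A real quadratic polynomial that is nonnegative has nonpositive discriminant. -/
theorem sq_le_mul_of_forall_quadratic {a b c : ℝ}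
    (h : ∀ s : ℝ, 0 ≤ a * s ^ 2 - 2 * b * s + c) : b ^ 2 ≤ a * c := by
  have := discrim_le_zero (a := a) (b := -2 * b) (c := c) fun s => by nlinarith [h s]
  rw [discrim] at this
  nlinarith

theorem torusInt_mul_sq_le (hf : Continuous f) (hg : Continuous g) :
    torusInt (fun x => f x * g x) ^ 2
      ≤ torusInt (fun x => f x ^ 2) * torusInt (fun x => g x ^ 2) := by
  refine sq_le_mul_of_forall_quadratic fun s => ?_
  have h : 0 ≤ torusInt (fun x => (s * f x - g x) ^ 2) := torusInt_nonneg fun x => sq_nonneg _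
  have e : (fun x => (s * f x - g x) ^ 2)
      = fun x => (s ^ 2 * f x ^ 2 - (2 * s) * (f x * g x)) + g x ^ 2 := by
    funext x; ring
  rw [e, torusInt_add (by fun_prop) (by fun_prop), torusInt_sub (by fun_prop) (by fun_prop),
    torusInt_const_mul, torusInt_const_mul] at h
  linarith

end TorusIntegral

section IntegrationByParts

variable {n : ℕ} {f g : (Fin (n + 1) → ℝ) → ℝ}

theorem torusInt_pd (hf : SmoothPer f) (i : Fin (n + 1)) : torusInt (pd i f) = 0 := by
  have hle : (0 : Fin (n + 1) → ℝ) ≤ fun _ => (1 : ℝ) := fun _ => zero_le_one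
  have hsum : ∀ x, (∑ j : Fin (n + 1),
      (if j = i then fderiv ℝ f x else 0) (Pi.single j (1 : ℝ))) = pd i f x := by
    intro x
    rw [Finset.sum_eq_single i]
    · simp [pd]
    · intro j _ hj; simp [hj]
    · simp
  have h := integral_divergence_of_hasFDerivAt_off_countable' (0 : Fin (n + 1) → ℝ)
    (fun _ => (1 : ℝ)) hle (fun j x => if j = i then f x else 0)
    (fun j x => if j = i then fderiv ℝ f x else 0) ∅ countable_empty
    (fun j => by by_cases hj : j = i <;> simp [hj, hf.continuous.continuousOn, continuousOn_const])
    (fun x _ j => by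
      by_cases hj : j = i
      · simpa [hj] using (hf.differentiable x).hasFDerivAt
      · simpa [hj] using hasFDerivAt_const (0 : ℝ) x)
    (by
      simp only [hsum]
      exact (hf.pd i).continuous.integrableOn_box)
  simp only [hsum] at h
  refine h.trans (Finset.sum_eq_zero fun j _ => ?_)
  by_cases hj : j = i
  · subst hj
    simp only [if_true, sub_eq_zero]
    congr 1
    funext x
    have e : (j.insertNth (1 : ℝ) x : Fin (n + 1) → ℝ)
        = j.insertNth (0 : ℝ) x + Pi.single j 1 := by
      funext k
      refine j.succAboveCases ?_ (fun k => ?_) k <;> simp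
    simp only [Pi.zero_apply, e]
    exact hf.per _ j
  · simp [hj]

theorem torusInt_mul_pd (hf : SmoothPer f) (hg : SmoothPer g) (i : Fin (n + 1)) :
    torusInt (fun x => f x * pd i g x) = -torusInt (fun x => pd i f x * g x) := by
  have h := torusInt_pd (hf.mul hg) i
  rw [pd_mul hf hg, torusInt_add (hf.mul (hg.pd i)).continuous
    ((hf.pd i).mul hg).continuous] at h
  linarith

end IntegrationByParts

section OneDimensional

variable {g g' : ℝ → ℝ}

theorem sq_integral_unit_le (hg : Continuous g) :
    (∫ x in (0 : ℝ)..1, g x) ^ 2 ≤ ∫ x in (0 : ℝ)..1, g x ^ 2 := by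
  set m := ∫ x in (0 : ℝ)..1, g x with hm
  have h : 0 ≤ ∫ x in (0 : ℝ)..1, (g x - m) ^ 2 :=
    intervalIntegral.integral_nonneg zero_le_one fun x _ => sq_nonneg _
  have e : (fun x => (g x - m) ^ 2) = fun x => (g x ^ 2 - (2 * m) * g x) + m ^ 2 := by
    funext x; ring
  rw [e, intervalIntegral.integral_add (by apply Continuous.intervalIntegrable; fun_prop)
    (by simp), intervalIntegral.integral_sub (by apply Continuous.intervalIntegrable; fun_prop)
    (by apply Continuous.intervalIntegrable; fun_prop), intervalIntegral.integral_const_mul,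
    ← hm] at h
  simp at h
  nlinarith

theorem integral_sq_unit_le_of_osc (hg : Continuous g) {K : ℝ}
    (hK : ∀ x ∈ Icc (0 : ℝ) 1, ∀ y ∈ Icc (0 : ℝ) 1, (g x - g y) ^ 2 ≤ K) :
    ∫ x in (0 : ℝ)..1, g x ^ 2 ≤ (∫ x in (0 : ℝ)..1, g x) ^ 2 + K / 2 := by
  set m := ∫ x in (0 : ℝ)..1, g x with hm
  set q := ∫ x in (0 : ℝ)..1, g x ^ 2 with hq
  have h1 : ∀ x ∈ Icc (0 : ℝ) 1, g x ^ 2 - (2 * m) * g x + q ≤ K := by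
    intro x hx
    have h : ∫ y in (0 : ℝ)..1, (g x - g y) ^ 2 ≤ ∫ y in (0 : ℝ)..1, K :=
      intervalIntegral.integral_mono_on zero_le_one
        (by apply Continuous.intervalIntegrable; fun_prop) (by simp) fun y hy => hK x hx y hy
    have e : (fun y => (g x - g y) ^ 2) = fun y => (g y ^ 2 - (2 * g x) * g y) + g x ^ 2 := by
      funext y; ring
    rw [e, intervalIntegral.integral_add (by apply Continuous.intervalIntegrable; fun_prop)
      (by simp), intervalIntegral.integral_sub (by apply Continuous.intervalIntegrable; fun_prop)
      (by apply Continuous.intervalIntegrable; fun_prop), intervalIntegral.integral_const_mul,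
      ← hm, ← hq] at h
    simp at h
    linarith
  have h2 : ∫ x in (0 : ℝ)..1, (g x ^ 2 - (2 * m) * g x + q) ≤ ∫ x in (0 : ℝ)..1, K :=
    intervalIntegral.integral_mono_on zero_le_one
      (by apply Continuous.intervalIntegrable; fun_prop) (by simp) h1
  rw [intervalIntegral.integral_add (by apply Continuous.intervalIntegrable; fun_prop)
    (by simp), intervalIntegral.integral_sub (by apply Continuous.intervalIntegrable; fun_prop)
    (by apply Continuous.intervalIntegrable; fun_prop), intervalIntegral.integral_const_mul,
    ← hm, ← hq] at h2
  simp at h2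
  nlinarith

theorem abs_sub_le_integral_abs_deriv (hd : ∀ x, HasDerivAt g (g' x) x) (hg' : Continuous g')
    {x y : ℝ} (hx : x ∈ Icc (0 : ℝ) 1) (hy : y ∈ Icc (0 : ℝ) 1) :
    |g x - g y| ≤ ∫ s in (0 : ℝ)..1, |g' s| := by
  wlog h : y ≤ x generalizing x y
  · rw [abs_sub_comm]
    exact this hy hx (le_of_not_ge h)
  rw [← intervalIntegral.integral_eq_sub_of_hasDerivAt (fun s _ => hd s)
    (hg'.intervalIntegrable _ _)]
  refine (intervalIntegral.abs_integral_le_integral_abs h).trans ?_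
  exact intervalIntegral.integral_mono_interval hy.1 h hx.2
    (Filter.Eventually.of_forall fun s => abs_nonneg _) (hg'.abs.intervalIntegrable _ _)

theorem sq_sub_le_integral_sq_deriv (hd : ∀ x, HasDerivAt g (g' x) x) (hg' : Continuous g')
    {x y : ℝ} (hx : x ∈ Icc (0 : ℝ) 1) (hy : y ∈ Icc (0 : ℝ) 1) :
    (g x - g y) ^ 2 ≤ ∫ s in (0 : ℝ)..1, g' s ^ 2 := by
  have h1 := abs_sub_le_integral_abs_deriv hd hg' hx hy
  have h2 := sq_integral_unit_le hg'.abs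
  simp only [sq_abs] at h2
  refine le_trans ?_ h2
  rw [← sq_abs]
  gcongr

theorem le_integral_add_integral_abs_deriv (hd : ∀ x, HasDerivAt g (g' x) x)
    (hg' : Continuous g') {x : ℝ} (hx : x ∈ Icc (0 : ℝ) 1) :
    g x ≤ (∫ s in (0 : ℝ)..1, g s) + ∫ s in (0 : ℝ)..1, |g' s| := by
  have hg : Continuous g := continuous_iff_continuousAt.2 fun y => (hd y).continuousAt
  have h : ∫ y in (0 : ℝ)..1, g x ≤ ∫ y in (0 : ℝ)..1, (g y + ∫ s in (0 : ℝ)..1, |g' s|) := by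
    refine intervalIntegral.integral_mono_on zero_le_one (by simp)
      (by apply Continuous.intervalIntegrable; fun_prop) fun y hy => ?_
    have := (le_abs_self _).trans (abs_sub_le_integral_abs_deriv hd hg' hx hy)
    linarith
  rw [intervalIntegral.integral_add (hg.intervalIntegrable _ _) (by simp)] at h
  simpa using h

end OneDimensional

section TwoDimensional

variable {f : (Fin 2 → ℝ) → ℝ}

theorem hasDerivAt_fst_of_smoothPer (hf : SmoothPer f) (x y : ℝ) :
    HasDerivAt (fun s => f ![s, y]) (pd 0 f ![x, y]) x := by
  have h : HasDerivAt (fun s : ℝ => (![s, y] : Fin 2 → ℝ)) (Pi.single 0 1) x := by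
    rw [hasDerivAt_pi]
    intro i
    fin_cases i
    · simpa using hasDerivAt_id' x
    · simpa using hasDerivAt_const x y
  exact (hf.differentiable ![x, y]).hasFDerivAt.comp_hasDerivAt x h

theorem hasDerivAt_snd_of_smoothPer (hf : SmoothPer f) (x y : ℝ) :
    HasDerivAt (fun s => f ![x, s]) (pd 1 f ![x, y]) y := by
  have h : HasDerivAt (fun s : ℝ => (![x, s] : Fin 2 → ℝ)) (Pi.single 1 1) y := by
    rw [hasDerivAt_pi]
    intro i
    fin_cases i
    · simpa using hasDerivAt_const y x
    · simpa using hasDerivAt_id' y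
  exact (hf.differentiable ![x, y]).hasFDerivAt.comp_hasDerivAt y h

theorem continuous_vec_two : Continuous fun p : ℝ × ℝ => (![p.1, p.2] : Fin 2 → ℝ) := by
  refine continuous_pi fun i => ?_
  fin_cases i
  · exact continuous_fst
  · exact continuous_snd

theorem Continuous.comp_vec_two (hf : Continuous f) :
    Continuous fun p : ℝ × ℝ => f ![p.1, p.2] := hf.comp continuous_vec_two

theorem torusInt_eq_integral_prod (f : (Fin 2 → ℝ) → ℝ) :
    torusInt f = ∫ p in Icc (0 : ℝ) 1 ×ˢ Icc (0 : ℝ) 1, f ![p.1, p.2] := by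
  have hv := (volume_preserving_finTwoArrow ℝ).symm
  have h := hv.setIntegral_preimage_emb
    (MeasurableEquiv.measurableEmbedding _) f (box 2 1)
  rw [torusInt, ← h]
  have hs : (MeasurableEquiv.finTwoArrow (α := ℝ)).symm ⁻¹' (box 2 1)
      = Icc (0 : ℝ) 1 ×ˢ Icc (0 : ℝ) 1 := by
    ext p
    simp only [box, mem_preimage, mem_Icc, mem_prod, Pi.le_def, Fin.forall_fin_two]
    simp [MeasurableEquiv.finTwoArrow]
    tauto
  rw [hs]
  rfl

theorem torusInt_eq_integral_integral (hf : Continuous f) :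
    torusInt f = ∫ x in (0 : ℝ)..1, ∫ y in (0 : ℝ)..1, f ![x, y] := by
  rw [torusInt_eq_integral_prod, Measure.volume_eq_prod, setIntegral_prod]
  · simp only [intervalIntegral.integral_of_le zero_le_one, integral_Icc_eq_integral_Ioc]
  · exact hf.comp_vec_two.continuousOn.integrableOn_compact (isCompact_Icc.prod isCompact_Icc)

theorem torusInt_eq_integral_integral_swap (hf : Continuous f) :
    torusInt f = ∫ y in (0 : ℝ)..1, ∫ x in (0 : ℝ)..1, f ![x, y] := by
  rw [torusInt_eq_integral_integral hf]
  refine intervalIntegral_intervalIntegral_swap ?_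
  simp only [uIoc_of_le (zero_le_one' ℝ)]
  exact (hf.comp_vec_two.continuousOn.integrableOn_compact
    (isCompact_Icc.prod isCompact_Icc)).mono_set
    (prod_mono Ioc_subset_Icc_self Ioc_subset_Icc_self)

/-- Poincaré inequality on the unit torus. -/
theorem two_mul_torusInt_sq_le (hf : SmoothPer f) (h0 : torusInt f = 0) :
    2 * torusInt (fun x => f x ^ 2)
      ≤ torusInt (fun x => pd 0 f x ^ 2) + torusInt (fun x => pd 1 f x ^ 2) := by
  have hc := hf.continuous
  have hc0 := (hf.pd 0).continuous
  have hc1 := (hf.pd 1).continuous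
  have hcv := hc.comp_vec_two
  have hc0v := hc0.comp_vec_two
  have hc1v := hc1.comp_vec_two
  have hx : ∀ y, Continuous fun x => f ![x, y] := fun y =>
    hcv.comp (continuous_id.prodMk continuous_const)
  have hx0 : ∀ y, Continuous fun x => pd 0 f ![x, y] := fun y =>
    hc0v.comp (continuous_id.prodMk continuous_const)
  have hy1 : ∀ x, Continuous fun y => pd 1 f ![x, y] := fun x =>
    hc1v.comp (continuous_const.prodMk continuous_id)
  have hsw : ∀ {G : (Fin 2 → ℝ) → ℝ}, Continuous G →
      Continuous fun y => ∫ x in (0 : ℝ)..1, G ![x, y] := fun {G} hG =>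
    intervalIntegral.continuous_parametric_intervalIntegral_of_continuous'
      (f := fun y x => G ![x, y])
      (hG.comp_vec_two.comp (continuous_snd.prodMk continuous_fst)) 0 1
  have hm := hsw hc
  have hq := hsw (G := fun x => f x ^ 2) (by fun_prop)
  have hq0 := hsw (G := fun x => pd 0 f x ^ 2) (by fun_prop)
  rw [torusInt_eq_integral_integral_swap hc] at h0
  have hslice : ∀ y, ∫ x in (0 : ℝ)..1, f ![x, y] ^ 2
      ≤ (∫ x in (0 : ℝ)..1, f ![x, y]) ^ 2 + (∫ x in (0 : ℝ)..1, pd 0 f ![x, y] ^ 2) / 2 :=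
    fun y => integral_sq_unit_le_of_osc (hx y) fun s hs t ht =>
      sq_sub_le_integral_sq_deriv (fun z => hasDerivAt_fst_of_smoothPer hf z y) (hx0 y) hs ht
  have hmean : ∫ y in (0 : ℝ)..1, (∫ x in (0 : ℝ)..1, f ![x, y]) ^ 2
      ≤ torusInt (fun x => pd 1 f x ^ 2) / 2 := by
    have h := integral_sq_unit_le_of_osc hm (K := torusInt (fun x => pd 1 f x ^ 2)) ?_
    · rw [h0] at h
      simpa using h
    intro s hs t ht
    rw [torusInt_eq_integral_integral (by fun_prop),
      ← intervalIntegral.integral_sub ((hx s).intervalIntegrable _ _)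
      ((hx t).intervalIntegrable _ _)]
    refine (sq_integral_unit_le ((hx s).sub (hx t))).trans ?_
    refine intervalIntegral.integral_mono_on zero_le_one
      ((((hx s).sub (hx t)).pow 2).intervalIntegrable _ _) ?_ fun x _ =>
      sq_sub_le_integral_sq_deriv (fun z => hasDerivAt_snd_of_smoothPer hf x z) (hy1 x) hs ht
    apply Continuous.intervalIntegrable
    exact intervalIntegral.continuous_parametric_intervalIntegral_of_continuous'
      (f := fun x y => pd 1 f ![x, y] ^ 2)
      (show Continuous fun x => pd 1 f x ^ 2 by fun_prop).comp_vec_two 0 1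
  have hm2 : Continuous fun y => (∫ x in (0 : ℝ)..1, f ![x, y]) ^ 2 := hm.pow 2
  have hfin := intervalIntegral.integral_mono_on (μ := volume) zero_le_one (hq.intervalIntegrable 0 1)
    ((hm2.add (hq0.div_const 2)).intervalIntegrable _ _) fun y _ => hslice y
  simp only [Pi.add_apply] at hfin
  rw [intervalIntegral.integral_add (hm2.intervalIntegrable _ _)
    ((hq0.div_const 2).intervalIntegrable _ _), intervalIntegral.integral_div] at hfin
  rw [torusInt_eq_integral_integral_swap (f := fun x => f x ^ 2) (by fun_prop),
    torusInt_eq_integral_integral_swap (f := fun x => pd 0 f x ^ 2) (by fun_prop)]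
  linarith

/-- Ladyzhenskaya's inequality on the unit torus. -/
theorem torusInt_pow_four_le (hf : SmoothPer f) (h0 : torusInt f = 0) :
    torusInt (fun x => f x ^ 4) ≤ 9 * (torusInt (fun x => f x ^ 2)
      * (torusInt (fun x => pd 0 f x ^ 2) + torusInt (fun x => pd 1 f x ^ 2))) := by
  have hP := two_mul_torusInt_sq_le hf h0
  have hc := hf.continuous
  have hc0 := (hf.pd 0).continuous
  have hc1 := (hf.pd 1).continuous
  have hd0 : ∀ x y, HasDerivAt (fun s => f ![s, y] ^ 2) (2 * (f ![x, y] * pd 0 f ![x, y])) x :=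
    fun x y => ((hasDerivAt_fst_of_smoothPer hf x y).pow 2).congr_deriv (by norm_num; ring)
  have hd1 : ∀ x y, HasDerivAt (fun s => f ![x, s] ^ 2) (2 * (f ![x, y] * pd 1 f ![x, y])) y :=
    fun x y => ((hasDerivAt_snd_of_smoothPer hf x y).pow 2).congr_deriv (by norm_num; ring)
  set G : Fin 2 → (Fin 2 → ℝ) → ℝ := fun i x => f x ^ 2 + |2 * (f x * pd i f x)| with hG
  have hGc : ∀ i, Continuous (G i) := fun i => by
    have := (hf.pd i).continuous
    fun_prop
  have hGv := fun i => (hGc i).comp_vec_two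
  have hcx : ∀ {F : (Fin 2 → ℝ) → ℝ}, Continuous F → ∀ y, Continuous fun x => F ![x, y] :=
    fun hF y => hF.comp_vec_two.comp (continuous_id.prodMk continuous_const)
  have hcy : ∀ {F : (Fin 2 → ℝ) → ℝ}, Continuous F → ∀ x, Continuous fun y => F ![x, y] :=
    fun hF y => hF.comp_vec_two.comp (continuous_const.prodMk continuous_id)
  have hS : ∀ i, torusInt (G i) ^ 2 ≤ 9 * (torusInt (fun x => f x ^ 2)
      * (torusInt (fun x => pd 0 f x ^ 2) + torusInt (fun x => pd 1 f x ^ 2))) := by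
    intro i
    have hci := (hf.pd i).continuous
    have h1 : torusInt (fun x => |f x| * |pd i f x|) ^ 2 ≤ _ :=
      torusInt_mul_sq_le hc.abs hci.abs
    simp only [sq_abs] at h1
    have h2 : torusInt (G i)
        = torusInt (fun x => f x ^ 2) + 2 * torusInt (fun x => |f x| * |pd i f x|) := by
      rw [← torusInt_const_mul, ← torusInt_add (by fun_prop) (by fun_prop)]
      congr 1
      funext x
      simp [hG, abs_mul]
    have h3 : torusInt (fun x => pd i f x ^ 2)
        ≤ torusInt (fun x => pd 0 f x ^ 2) + torusInt (fun x => pd 1 f x ^ 2) := by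
      have a0 : 0 ≤ torusInt (fun x => pd 0 f x ^ 2) := torusInt_nonneg fun x => sq_nonneg _
      have a1 : 0 ≤ torusInt (fun x => pd 1 f x ^ 2) := torusInt_nonneg fun x => sq_nonneg _
      fin_cases i <;> simp <;> assumption
    have ha : 0 ≤ torusInt (fun x => f x ^ 2) := torusInt_nonneg fun x => sq_nonneg _
    have hp : 0 ≤ torusInt (fun x => |f x| * |pd i f x|) := torusInt_nonneg fun x => by positivity
    rw [h2]
    set a := torusInt (fun x => f x ^ 2)
    set p := torusInt (fun x => |f x| * |pd i f x|)
    set b := torusInt (fun x => pd 0 f x ^ 2) + torusInt (fun x => pd 1 f x ^ 2)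
    have h4 : p ^ 2 ≤ a * b := h1.trans (by gcongr)
    have hab : a ^ 2 ≤ a * b := by nlinarith
    nlinarith [sq_nonneg (a - p)]
  have hbound : torusInt (fun x => f x ^ 4) ≤ torusInt (G 0) * torusInt (G 1) := by
    rw [torusInt_eq_integral_integral_swap (hGc 0), torusInt_eq_integral_integral (hGc 1),
      torusInt_eq_integral_integral (by fun_prop), mul_comm,
      ← intervalIntegral.integral_mul_const]
    have hA : Continuous fun y => ∫ x in (0 : ℝ)..1, G 0 ![x, y] :=
      intervalIntegral.continuous_parametric_intervalIntegral_of_continuous'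
        (f := fun y x => G 0 ![x, y]) ((hGv 0).comp (continuous_snd.prodMk continuous_fst)) 0 1
    have hB : Continuous fun x => ∫ y in (0 : ℝ)..1, G 1 ![x, y] :=
      intervalIntegral.continuous_parametric_intervalIntegral_of_continuous'
        (f := fun x y => G 1 ![x, y]) (hGv 1) 0 1
    refine intervalIntegral.integral_mono_on zero_le_one ?_
      ((hB.mul continuous_const).intervalIntegrable _ _) fun x hx => ?_
    · apply Continuous.intervalIntegrable
      exact intervalIntegral.continuous_parametric_intervalIntegral_of_continuous'
        (f := fun x y => f ![x, y] ^ 4)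
        (show Continuous fun x => f x ^ 4 by fun_prop).comp_vec_two 0 1
    rw [← intervalIntegral.integral_const_mul]
    refine intervalIntegral.integral_mono_on zero_le_one
      ((hcy (F := fun x => f x ^ 4) (by fun_prop) x).intervalIntegrable _ _)
      ((continuous_const.mul hA).intervalIntegrable _ _) fun y hy => ?_
    have e0 : f ![x, y] ^ 2 ≤ ∫ x in (0 : ℝ)..1, G 0 ![x, y] := by
      have hk : Continuous fun x => 2 * (f ![x, y] * pd 0 f ![x, y]) :=
        hcx (F := fun x => 2 * (f x * pd 0 f x)) (by fun_prop) y
      refine (le_integral_add_integral_abs_deriv (fun z => hd0 z y) hk hx).trans_eq ?_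
      rw [← intervalIntegral.integral_add ((hcx (F := fun x => f x ^ 2) (by fun_prop) y).intervalIntegrable _ _)
        (hk.abs.intervalIntegrable _ _)]
    have e1 : f ![x, y] ^ 2 ≤ ∫ y in (0 : ℝ)..1, G 1 ![x, y] := by
      have hk : Continuous fun y => 2 * (f ![x, y] * pd 1 f ![x, y]) :=
        hcy (F := fun x => 2 * (f x * pd 1 f x)) (by fun_prop) x
      refine (le_integral_add_integral_abs_deriv (fun z => hd1 x z) hk hy).trans_eq ?_
      rw [← intervalIntegral.integral_add ((hcy (F := fun x => f x ^ 2) (by fun_prop) x).intervalIntegrable _ _)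
        (hk.abs.intervalIntegrable _ _)]
    calc f ![x, y] ^ 4 = f ![x, y] ^ 2 * f ![x, y] ^ 2 := by ring
      _ ≤ _ := mul_le_mul e1 e0 (sq_nonneg _) ((sq_nonneg _).trans e1)
  nlinarith [hS 0, hS 1, sq_nonneg (torusInt (G 0) - torusInt (G 1))]

end TwoDimensional

section LogConvex

variable {a : ℕ → ℝ}

theorem logConvex_mul_le_mul (h0 : ∀ k, 0 ≤ a k) (h : ∀ k, a (k + 1) ^ 2 ≤ a k * a (k + 2))
    (p n : ℕ) : a (p + 1) * a (p + n) ≤ a p * a (p + n + 1) := by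
  induction n with
  | zero => rw [add_zero, mul_comm]
  | succ n ih =>
    rcases (h0 (p + n + 1)).eq_or_lt with hz | hz
    · rw [← add_assoc, ← hz, mul_zero]
      exact mul_nonneg (h0 _) (h0 _)
    · refine le_of_mul_le_mul_right ?_ hz
      calc a (p + 1) * a (p + n + 1) * a (p + n + 1)
          = a (p + 1) * a (p + n + 1) ^ 2 := by ring
        _ ≤ a (p + 1) * (a (p + n) * a (p + n + 2)) :=
          mul_le_mul_of_nonneg_left (h (p + n)) (h0 _)
        _ = (a (p + 1) * a (p + n)) * a (p + n + 2) := by ring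
        _ ≤ (a p * a (p + n + 1)) * a (p + n + 2) := mul_le_mul_of_nonneg_right ih (h0 _)
        _ = a p * a (p + (n + 1) + 1) * a (p + n + 1) := by
          rw [show p + (n + 1) + 1 = p + n + 2 by ring]; ring

theorem logConvex_mul_le (h0 : ∀ k, 0 ≤ a k) (h : ∀ k, a (k + 1) ^ 2 ≤ a k * a (k + 2))
    (p q : ℕ) : a p * a q ≤ a 0 * a (p + q) := by
  wlog hpq : p ≤ q generalizing p q
  · rw [mul_comm, add_comm]
    exact this q p (le_of_not_ge hpq)
  induction p generalizing q with
  | zero => simp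
  | succ p ih =>
    obtain ⟨n, rfl⟩ := Nat.exists_eq_add_of_le hpq
    have h1 := logConvex_mul_le_mul h0 h p (n + 1)
    have h2 := ih (p + (n + 1) + 1) (by omega)
    rw [show p + 1 + n = p + (n + 1) by ring]
    refine h1.trans (h2.trans_eq ?_)
    congr 2
    ring

end LogConvex

section GradEnergy

variable {ι : Type*} [Fintype ι]

/-- The squared `L²` norm of the full `k`-th gradient of a finite family of functions on the
two-dimensional torus. -/
def gradEnergy (k : ℕ) (z : ι → (Fin 2 → ℝ) → ℝ) : ℝ :=
  ∑ c, ∑ l : Fin k → Fin 2, torusInt (fun x => pdList (List.ofFn l) (z c) x ^ 2)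

variable {z : ι → (Fin 2 → ℝ) → ℝ}

theorem gradEnergy_nonneg (k : ℕ) (z : ι → (Fin 2 → ℝ) → ℝ) : 0 ≤ gradEnergy k z :=
  Finset.sum_nonneg fun _ _ => Finset.sum_nonneg fun _ _ => torusInt_nonneg fun _ => sq_nonneg _

theorem gradEnergy_sum_elim {κ : Type*} [Fintype κ] (k : ℕ) (z : ι → (Fin 2 → ℝ) → ℝ)
    (w : κ → (Fin 2 → ℝ) → ℝ) :
    gradEnergy k (Sum.elim z w) = gradEnergy k z + gradEnergy k w := by
  simp [gradEnergy, Fintype.sum_sum_type]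

theorem sum_ofFn_succ (k : ℕ) (F : List (Fin 2) → ℝ) :
    ∑ l : Fin (k + 1) → Fin 2, F (List.ofFn l)
      = ∑ l : Fin k → Fin 2, ∑ i, F (i :: List.ofFn l) := by
  rw [← (Fin.consEquiv fun _ : Fin (k + 1) => Fin 2).sum_comp, Fintype.sum_prod_type,
    Finset.sum_comm]
  simp [Fin.consEquiv, List.ofFn_succ]

theorem gradEnergy_succ (k : ℕ) (z : ι → (Fin 2 → ℝ) → ℝ) :
    gradEnergy (k + 1) z = ∑ c, ∑ l : Fin k → Fin 2, ∑ i,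
      torusInt (fun x => pd i (pdList (List.ofFn l) (z c)) x ^ 2) :=
  Finset.sum_congr rfl fun c _ =>
    sum_ofFn_succ k fun l => torusInt (fun x => pdList l (z c) x ^ 2)

theorem exists_ofFn_eq {α : Type*} {l : List α} {k : ℕ} (hl : l.length = k) :
    ∃ m : Fin k → α, List.ofFn m = l := by
  subst hl
  exact ⟨l.get, List.ofFn_get l⟩

theorem torusInt_pdList_sq_le (z : ι → (Fin 2 → ℝ) → ℝ) (c : ι) {l : List (Fin 2)} {k : ℕ}
    (hl : l.length = k) : torusInt (fun x => pdList l (z c) x ^ 2) ≤ gradEnergy k z := by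
  subst hl
  have h1 := Finset.single_le_sum (f := fun m : Fin l.length → Fin 2 =>
    torusInt (fun x => pdList (List.ofFn m) (z c) x ^ 2))
    (fun _ _ => torusInt_nonneg fun _ => sq_nonneg _) (Finset.mem_univ l.get)
  have h2 := Finset.single_le_sum (f := fun c => ∑ m : Fin l.length → Fin 2,
    torusInt (fun x => pdList (List.ofFn m) (z c) x ^ 2))
    (fun _ _ => Finset.sum_nonneg fun _ _ => torusInt_nonneg fun _ => sq_nonneg _)
    (Finset.mem_univ c)
  simp only [List.ofFn_get] at h1
  exact h1.trans h2

theorem torusInt_sq_laplacian {f : (Fin 2 → ℝ) → ℝ} (hf : SmoothPer f) :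
    torusInt (fun x => (∑ i, pd i (pd i f) x) ^ 2)
      = ∑ i, ∑ j, torusInt (fun x => pd j (pd i f) x ^ 2) := by
  have e : (fun x => (∑ i, pd i (pd i f) x) ^ 2)
      = fun x => ∑ i, ∑ j, pd i (pd i f) x * pd j (pd j f) x := by
    funext x
    rw [sq, Finset.sum_mul_sum]
  have hs : ∀ i j, SmoothPer fun x => pd i (pd i f) x * pd j (pd j f) x :=
    fun i j => ((hf.pd i).pd i).mul ((hf.pd j).pd j)
  rw [e, torusInt_sum _ fun i _ => (SmoothPer.sum _ fun j _ => hs i j).continuous]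
  refine Finset.sum_congr rfl fun i _ => ?_
  rw [torusInt_sum _ fun j _ => (hs i j).continuous]
  refine Finset.sum_congr rfl fun j _ => ?_
  have h1 := torusInt_mul_pd (hf.pd i) ((hf.pd j).pd j) i
  have h2 := torusInt_mul_pd (hf.pd i) ((hf.pd i).pd j) j
  rw [pd_comm (hf.pd j) i j, pd_comm hf i j] at h1
  rw [h1] at h2
  simp only [sq]
  linarith

theorem gradEnergy_quadratic (hz : ∀ c, SmoothPer (z c)) (k : ℕ) (s : ℝ) :
    0 ≤ gradEnergy k z * s ^ 2 - 2 * gradEnergy (k + 1) z * s + gradEnergy (k + 2) z := by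
  have key : ∀ f : (Fin 2 → ℝ) → ℝ, SmoothPer f →
      0 ≤ torusInt (fun x => f x ^ 2) * s ^ 2 - 2 * (∑ i, torusInt (fun x => pd i f x ^ 2)) * s
        + ∑ i, ∑ j, torusInt (fun x => pd j (pd i f) x ^ 2) := by
    intro f hf
    have hL : SmoothPer fun x => ∑ i, pd i (pd i f) x :=
      SmoothPer.sum _ fun i _ => (hf.pd i).pd i
    have h0 : 0 ≤ torusInt (fun x => (s * f x + ∑ i, pd i (pd i f) x) ^ 2) :=
      torusInt_nonneg fun x => sq_nonneg _
    have e : (fun x => (s * f x + ∑ i, pd i (pd i f) x) ^ 2)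
        = fun x => (s ^ 2 * f x ^ 2 + (2 * s) * ∑ i, f x * pd i (pd i f) x)
          + (∑ i, pd i (pd i f) x) ^ 2 := by
      funext x
      rw [← Finset.mul_sum]
      ring
    have hM : SmoothPer fun x => ∑ i, f x * pd i (pd i f) x :=
      SmoothPer.sum _ fun i _ => hf.mul ((hf.pd i).pd i)
    rw [e, torusInt_add (((hf.pow 2).const_mul _).add (hM.const_mul _)).continuous
      (hL.pow 2).continuous,
      torusInt_add ((hf.pow 2).const_mul _).continuous (hM.const_mul _).continuous,
      torusInt_const_mul, torusInt_const_mul, torusInt_sq_laplacian hf,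
      torusInt_sum _ fun i _ => (hf.mul ((hf.pd i).pd i)).continuous] at h0
    have h1 : ∀ i, torusInt (fun x => f x * pd i (pd i f) x)
        = -torusInt (fun x => pd i f x ^ 2) := fun i => by
      rw [torusInt_mul_pd hf (hf.pd i)]
      simp only [sq]
    simp only [h1, Finset.sum_neg_distrib] at h0
    linarith
  have h := Finset.sum_nonneg fun c (_ : c ∈ Finset.univ) =>
    Finset.sum_nonneg fun l (_ : l ∈ (Finset.univ : Finset (Fin k → Fin 2))) =>
      key _ ((hz c).pdList (List.ofFn l))
  have e2 : gradEnergy (k + 2) z = ∑ c, ∑ l : Fin k → Fin 2, ∑ i, ∑ j,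
      torusInt (fun x => pd j (pd i (pdList (List.ofFn l) (z c))) x ^ 2) := by
    rw [gradEnergy_succ]
    exact Finset.sum_congr rfl fun c _ => sum_ofFn_succ k fun l =>
      ∑ j, torusInt (fun x => pd j (pdList l (z c)) x ^ 2)
  rw [e2, gradEnergy_succ, gradEnergy]
  simpa only [Finset.sum_add_distrib, Finset.sum_sub_distrib, Finset.sum_mul, Finset.mul_sum]
    using h

theorem gradEnergy_mul_le (hz : ∀ c, SmoothPer (z c)) (p q : ℕ) :
    gradEnergy (p + 1) z * gradEnergy (q + 1) z
      ≤ gradEnergy 1 z * gradEnergy (p + q + 1) z :=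
  logConvex_mul_le (a := fun k => gradEnergy (k + 1) z) (fun _ => gradEnergy_nonneg _ _)
    (fun k => sq_le_mul_of_forall_quadratic (gradEnergy_quadratic hz (k + 1))) p q

theorem torusInt_pdList_eq_zero {f : (Fin 2 → ℝ) → ℝ} (hf : SmoothPer f) {l : List (Fin 2)}
    (hl : l ≠ []) : torusInt (pdList l f) = 0 := by
  cases l with
  | nil => exact absurd rfl hl
  | cons i l => exact torusInt_pd (hf.pdList l) i

/-- Poincaré inequality for the gradient energies. -/
theorem two_mul_gradEnergy_le (hz : ∀ c, SmoothPer (z c)) (h0 : ∀ c, torusInt (z c) = 0)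
    (k : ℕ) : 2 * gradEnergy k z ≤ gradEnergy (k + 1) z := by
  rw [gradEnergy_succ, gradEnergy, Finset.mul_sum]
  refine Finset.sum_le_sum fun c _ => ?_
  rw [Finset.mul_sum]
  refine Finset.sum_le_sum fun l _ => ?_
  rw [Fin.sum_univ_two]
  refine two_mul_torusInt_sq_le ((hz c).pdList _) ?_
  by_cases hl : List.ofFn l = []
  · rw [hl]; exact h0 c
  · exact torusInt_pdList_eq_zero (hz c) hl

theorem torusInt_pdList_pow_four_le (hz : ∀ c, SmoothPer (z c)) (c : ι) {l : List (Fin 2)}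
    {k : ℕ} (hl : l.length = k + 1) :
    torusInt (fun x => pdList l (z c) x ^ 4)
      ≤ 9 * (gradEnergy (k + 1) z * gradEnergy (k + 2) z) := by
  have hne : l ≠ [] := by
    rintro rfl
    simp at hl
  refine (torusInt_pow_four_le ((hz c).pdList l) (torusInt_pdList_eq_zero (hz c) hne)).trans ?_
  have h1 := torusInt_pdList_sq_le z c hl
  have h2 : torusInt (fun x => pd 0 (pdList l (z c)) x ^ 2)
      + torusInt (fun x => pd 1 (pdList l (z c)) x ^ 2) ≤ gradEnergy (k + 2) z := by
    obtain ⟨m, rfl⟩ := exists_ofFn_eq hl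
    rw [gradEnergy_succ]
    have a1 := Finset.single_le_sum (f := fun m : Fin (k + 1) → Fin 2 => ∑ i,
      torusInt (fun x => pd i (pdList (List.ofFn m) (z c)) x ^ 2))
      (fun _ _ => Finset.sum_nonneg fun _ _ => torusInt_nonneg fun _ => sq_nonneg _)
      (Finset.mem_univ m)
    have a2 := Finset.single_le_sum (f := fun c => ∑ m : Fin (k + 1) → Fin 2, ∑ i,
      torusInt (fun x => pd i (pdList (List.ofFn m) (z c)) x ^ 2))
      (fun _ _ => Finset.sum_nonneg fun _ _ => Finset.sum_nonneg fun _ _ =>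
        torusInt_nonneg fun _ => sq_nonneg _) (Finset.mem_univ c)
    simp only [Fin.sum_univ_two] at a1
    simp only [Fin.sum_univ_two] at a2 ⊢
    exact a1.trans a2
  have h3 : 0 ≤ torusInt (fun x => pd 0 (pdList l (z c)) x ^ 2)
      + torusInt (fun x => pd 1 (pdList l (z c)) x ^ 2) :=
    add_nonneg (torusInt_nonneg fun _ => sq_nonneg _) (torusInt_nonneg fun _ => sq_nonneg _)
  have h4 := gradEnergy_nonneg (k + 1) z
  gcongr

theorem torusInt_mul_mul_pow_four_le {f g h : (Fin 2 → ℝ) → ℝ} (hf : Continuous f)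
    (hg : Continuous g) (hh : Continuous h) :
    torusInt (fun x => f x * g x * h x) ^ 4 ≤ torusInt (fun x => f x ^ 4)
      * torusInt (fun x => g x ^ 4) * torusInt (fun x => h x ^ 2) ^ 2 := by
  have h1 := torusInt_mul_sq_le (hf.mul hg) hh
  have h2 := torusInt_mul_sq_le (hf.pow 2) (hg.pow 2)
  simp only [Pi.mul_apply, Pi.pow_apply, ← pow_mul] at h1 h2
  have h3 : (fun x => (f x * g x) ^ 2) = fun x => f x ^ 2 * g x ^ 2 := by
    funext x; ring
  rw [h3] at h1
  calc torusInt (fun x => f x * g x * h x) ^ 4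
      = (torusInt (fun x => f x * g x * h x) ^ 2) ^ 2 := by ring
    _ ≤ (torusInt (fun x => f x ^ 2 * g x ^ 2) * torusInt (fun x => h x ^ 2)) ^ 2 := by
      gcongr
    _ = torusInt (fun x => f x ^ 2 * g x ^ 2) ^ 2 * torusInt (fun x => h x ^ 2) ^ 2 := by ring
    _ ≤ _ := by gcongr

/-- The trilinear estimate for the terms of the Leibniz expansion of the advection terms. -/
theorem abs_torusInt_trilinear_le (hz : ∀ c, SmoothPer (z c)) (c₁ c₂ c₃ : ι)
    {l₁ l₂ l : List (Fin 2)} (h₁ : 1 ≤ l₁.length) (h₂ : 1 ≤ l₂.length)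
    (h : l₁.length + l₂.length = l.length + 1) :
    |torusInt (fun x => pdList l₁ (z c₁) x * pdList l₂ (z c₂) x * pdList l (z c₃) x)|
      ≤ 3 * √(gradEnergy 1 z * gradEnergy l.length z * gradEnergy (l.length + 1) z) := by
  obtain ⟨p, hp⟩ := Nat.exists_eq_add_of_le' h₁
  obtain ⟨q, hq⟩ := Nat.exists_eq_add_of_le' h₂
  have hl : l.length = p + q + 1 := by omega
  have hE := fun k => gradEnergy_nonneg k z
  have h4 := torusInt_mul_mul_pow_four_le ((hz c₁).pdList l₁).continuous
    ((hz c₂).pdList l₂).continuous ((hz c₃).pdList l).continuous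
  set T := torusInt (fun x => pdList l₁ (z c₁) x * pdList l₂ (z c₂) x * pdList l (z c₃) x)
  rw [hl]
  have m1 := gradEnergy_mul_le hz p (q + 1)
  have m2 := gradEnergy_mul_le hz (p + 1) q
  rw [show p + (q + 1) + 1 = p + q + 1 + 1 by ring] at m1
  rw [show p + 1 + q + 1 = p + q + 1 + 1 by ring] at m2
  have b1 := torusInt_pdList_pow_four_le hz c₁ hp
  have b2 := torusInt_pdList_pow_four_le hz c₂ hq
  have b3 := torusInt_pdList_sq_le z c₃ hl
  have n1 : 0 ≤ torusInt (fun x => pdList l₁ (z c₁) x ^ 4) := torusInt_nonneg fun _ => by positivity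
  have n2 : 0 ≤ torusInt (fun x => pdList l₂ (z c₂) x ^ 4) := torusInt_nonneg fun _ => by positivity
  have n3 : 0 ≤ torusInt (fun x => pdList l (z c₃) x ^ 2) := torusInt_nonneg fun _ => by positivity
  set X := gradEnergy 1 z * gradEnergy (p + q + 1) z * gradEnergy (p + q + 1 + 1) z with hX
  have hX0 : 0 ≤ X := mul_nonneg (mul_nonneg (hE _) (hE _)) (hE _)
  have hT : (T ^ 2) ^ 2 ≤ (9 * X) ^ 2 := by
    calc (T ^ 2) ^ 2 = T ^ 4 := by ring
      _ ≤ _ := h4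
      _ ≤ 9 * (gradEnergy (p + 1) z * gradEnergy (p + 2) z)
          * (9 * (gradEnergy (q + 1) z * gradEnergy (q + 2) z)) * gradEnergy (p + q + 1) z ^ 2 := by
        have := hE (p + 1)
        have := hE (p + 2)
        have := hE (q + 1)
        have := hE (q + 2)
        gcongr
      _ = 81 * ((gradEnergy (p + 1) z * gradEnergy (q + 1 + 1) z)
          * (gradEnergy (p + 1 + 1) z * gradEnergy (q + 1) z)) * gradEnergy (p + q + 1) z ^ 2 := by
        ring
      _ ≤ 81 * ((gradEnergy 1 z * gradEnergy (p + q + 1 + 1) z)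
          * (gradEnergy 1 z * gradEnergy (p + q + 1 + 1) z)) * gradEnergy (p + q + 1) z ^ 2 := by
        have := mul_le_mul m1 m2 (mul_nonneg (hE _) (hE _)) (mul_nonneg (hE _) (hE _))
        gcongr
      _ = _ := by rw [hX]; ring
  have hT2 : T ^ 2 ≤ 9 * X := le_of_sq_le_sq hT (by positivity)
  have h9 : √(9 * X) = 3 * √X := by
    rw [Real.sqrt_mul (x := 9) (by norm_num) X, show (9 : ℝ) = 3 ^ 2 by norm_num,
      Real.sqrt_sq (by norm_num)]
  rw [← h9]
  exact Real.abs_le_sqrt hT2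

end GradEnergy

section Advection

/-- The `L²` inner product of scalar functions on the torus. -/
def torusInner {d : ℕ} (f g : (Fin d → ℝ) → ℝ) : ℝ := torusInt fun x => f x * g x

/-- The derivative `(v · ∇) f` of `f` along the vector field `v`. -/
def advect {d : ℕ} (v : Fin d → (Fin d → ℝ) → ℝ) (f : (Fin d → ℝ) → ℝ) : (Fin d → ℝ) → ℝ :=
  fun x => ∑ j, v j x * pd j f x

/-- The commutator of the iterated derivative along `l` with `(v · ∇)`, applied to `f`. -/
def advectComm {d : ℕ} (l : List (Fin d)) (v : Fin d → (Fin d → ℝ) → ℝ) (f : (Fin d → ℝ) → ℝ) :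
    (Fin d → ℝ) → ℝ :=
  fun x => ∑ j, ((leibnizPairs l).map fun p => pdList p.1 (v j) x * pdList (j :: p.2) f x).sum

section

variable {d : ℕ} {f g h : (Fin d → ℝ) → ℝ} {v : Fin d → (Fin d → ℝ) → ℝ}

theorem torusInner_add_left (hf : SmoothPer f) (hg : SmoothPer g) (hh : SmoothPer h) :
    torusInner (fun x => f x + g x) h = torusInner f h + torusInner g h := by
  simp only [torusInner, add_mul]
  exact torusInt_add (hf.mul hh).continuous (hg.mul hh).continuous

theorem torusInner_sub_left (hf : SmoothPer f) (hg : SmoothPer g) (hh : SmoothPer h) :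
    torusInner (fun x => f x - g x) h = torusInner f h - torusInner g h := by
  simp only [torusInner, sub_mul]
  exact torusInt_sub (hf.mul hh).continuous (hg.mul hh).continuous

theorem torusInner_const_mul_left (c : ℝ) (f h : (Fin d → ℝ) → ℝ) :
    torusInner (fun x => c * f x) h = c * torusInner f h := by
  simp only [torusInner, mul_assoc]
  exact torusInt_const_mul c _

theorem torusInner_comm (f g : (Fin d → ℝ) → ℝ) : torusInner f g = torusInner g f := by
  simp only [torusInner, mul_comm]

theorem torusInner_sum_left {ι : Type*} (s : Finset ι) {F : ι → (Fin d → ℝ) → ℝ}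
    (hF : ∀ a, SmoothPer (F a)) (hh : SmoothPer h) :
    torusInner (fun x => ∑ a ∈ s, F a x) h = ∑ a ∈ s, torusInner (F a) h := by
  simp only [torusInner, Finset.sum_mul]
  exact torusInt_sum s fun a _ => ((hF a).mul hh).continuous

theorem SmoothPer.advect (hv : ∀ j, SmoothPer (v j)) (hf : SmoothPer f) :
    SmoothPer (advect v f) :=
  SmoothPer.sum _ fun j _ => (hv j).mul (hf.pd j)

theorem SmoothPer.advectComm (hv : ∀ j, SmoothPer (v j)) (hf : SmoothPer f)
    (l : List (Fin d)) : SmoothPer (advectComm l v f) :=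
  SmoothPer.sum _ fun j _ => SmoothPer.list_sum _ fun p =>
    ((hv j).pdList p.1).mul (hf.pdList (j :: p.2))

theorem pdList_advect (hv : ∀ j, SmoothPer (v j)) (hf : SmoothPer f) (l : List (Fin d)) :
    pdList l (advect v f) = fun x => advect v (pdList l f) x + advectComm l v f x := by
  unfold advect advectComm
  rw [pdList_sum _ fun j _ => (hv j).mul (hf.pd j)]
  funext x
  rw [← Finset.sum_add_distrib]
  refine Finset.sum_congr rfl fun j _ => ?_
  rw [pdList_mul (hv j) (hf.pd j)]
  simp only [pdList_pd hf, pdList]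

end

variable {n : ℕ} {f g : (Fin (n + 1) → ℝ) → ℝ} {v : Fin (n + 1) → (Fin (n + 1) → ℝ) → ℝ}

theorem torusInner_advect_left (hv : ∀ j, SmoothPer (v j)) (hdiv : ∀ x, ∑ j, pd j (v j) x = 0)
    (hf : SmoothPer f) (hg : SmoothPer g) :
    torusInner (advect v f) g = -torusInner (advect v g) f := by
  have e : ∀ j, torusInner (fun x => v j x * pd j f x) g
      = -(torusInner (fun x => v j x * pd j g x) f
        + torusInt (fun x => pd j (v j) x * (g x * f x))) := fun j => by
    have h := torusInt_mul_pd ((hv j).mul hg) hf j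
    rw [pd_mul (hv j) hg] at h
    have e1 : torusInner (fun x => v j x * pd j f x) g
        = torusInt fun x => v j x * g x * pd j f x := by
      refine congrArg torusInt ?_
      funext x
      ring
    rw [e1, h, torusInner, ← torusInt_add (((hv j).mul (hg.pd j)).mul hf).continuous
      (((hv j).pd j).mul (hg.mul hf)).continuous]
    congr 2
    funext x
    ring
  have h1 : ∑ j, torusInt (fun x => pd j (v j) x * (g x * f x)) = 0 := by
    rw [← torusInt_sum _ fun j _ => (((hv j).pd j).mul (hg.mul hf)).continuous]
    simp only [← Finset.sum_mul, hdiv, zero_mul]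
    exact torusInt_zero
  unfold advect
  rw [torusInner_sum_left _ (fun j => (hv j).mul (hf.pd j)) hg,
    torusInner_sum_left _ (fun j => (hv j).mul (hg.pd j)) hf]
  simp only [e, neg_add, Finset.sum_add_distrib, Finset.sum_neg_distrib, h1]
  ring

theorem torusInner_pdList_laplacian (hf : SmoothPer f) (l : List (Fin (n + 1))) :
    torusInner (pdList l fun x => ∑ j, pd j (pd j f) x) (pdList l f)
      = -∑ j, torusInt (fun x => pd j (pdList l f) x ^ 2) := by
  rw [pdList_sum _ fun j _ => (hf.pd j).pd j,
    torusInner_sum_left _ (fun j => ((hf.pd j).pd j).pdList l) (hf.pdList l),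
    ← Finset.sum_neg_distrib]
  refine Finset.sum_congr rfl fun j _ => ?_
  rw [pdList_pd (hf.pd j), pdList_pd hf, torusInner_comm, torusInner,
    torusInt_mul_pd (hf.pdList l) ((hf.pdList l).pd j)]
  simp only [sq]

theorem sum_torusInner_pdList_grad (hv : ∀ j, SmoothPer (v j))
    (hdiv : ∀ x, ∑ j, pd j (v j) x = 0) (hf : SmoothPer f) (l : List (Fin (n + 1))) :
    ∑ j, torusInner (pdList l (pd j f)) (pdList l (v j)) = 0 := by
  have e : ∀ j, torusInner (pdList l (pd j f)) (pdList l (v j))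
      = -torusInner (pdList l (pd j (v j))) (pdList l f) := fun j => by
    rw [pdList_pd hf, pdList_pd (hv j), torusInner_comm, torusInner,
      torusInt_mul_pd ((hv j).pdList l) (hf.pdList l), torusInner]
  have h : (fun x => ∑ j, pd j (v j) x) = fun _ => 0 := funext hdiv
  simp only [e, Finset.sum_neg_distrib]
  rw [← torusInner_sum_left _ (fun j => ((hv j).pd j).pdList l) (hf.pdList l),
    ← pdList_sum _ fun j _ => (hv j).pd j, h, pdList_zero]
  simp [torusInner, torusInt_zero]

end Advection

theorem abs_list_sum_map_le {ι : Type*} (L : List ι) {F : ι → ℝ} {B : ℝ}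
    (h : ∀ a ∈ L, |F a| ≤ B) : |(L.map F).sum| ≤ L.length * B := by
  induction L with
  | nil => simp
  | cons a L ih =>
    simp only [List.map_cons, List.sum_cons, List.length_cons, Nat.cast_add, Nat.cast_one]
    have h1 := h a (by simp)
    have h2 := ih fun a ha => h a (by simp [ha])
    linarith [abs_add_le (F a) (L.map F).sum]

section EnergyIdentity

theorem abs_torusInner_advectComm_le {ι : Type*} [Fintype ι] {z : ι → (Fin 2 → ℝ) → ℝ}
    (hz : ∀ c, SmoothPer (z c)) (a : Fin 2 → ι) (c c' : ι) (l : List (Fin 2)) :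
    |torusInner (advectComm l (fun j => z (a j)) (z c)) (pdList l (z c'))|
      ≤ 6 * (leibnizPairs l).length
        * √(gradEnergy 1 z * gradEnergy l.length z * gradEnergy (l.length + 1) z) := by
  set X := gradEnergy 1 z * gradEnergy l.length z * gradEnergy (l.length + 1) z
  have hs : ∀ (j : Fin 2) (p : List (Fin 2) × List (Fin 2)),
      SmoothPer fun x => pdList p.1 (z (a j)) x * pdList (j :: p.2) (z c) x :=
    fun j p => ((hz _).pdList p.1).mul ((hz c).pdList (j :: p.2))
  have key : ∀ j : Fin 2, |torusInner (fun x => ((leibnizPairs l).map fun p =>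
      pdList p.1 (z (a j)) x * pdList (j :: p.2) (z c) x).sum) (pdList l (z c'))|
      ≤ (leibnizPairs l).length * (3 * √X) := fun j => by
    have e : torusInner (fun x => ((leibnizPairs l).map fun p =>
        pdList p.1 (z (a j)) x * pdList (j :: p.2) (z c) x).sum) (pdList l (z c'))
        = ((leibnizPairs l).map fun p => torusInt fun x =>
          pdList p.1 (z (a j)) x * pdList (j :: p.2) (z c) x * pdList l (z c') x).sum := by
      rw [torusInner, ← torusInt_list_sum _ fun p => (hs j p).mul ((hz c').pdList l)]
      simp only [List.sum_map_mul_right]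
    rw [e]
    refine abs_list_sum_map_le _ fun p hp => ?_
    obtain ⟨h1, h2⟩ := length_of_mem_leibnizPairs p hp
    exact abs_torusInt_trilinear_le hz _ _ _ h1 (by simp) (by simp only [List.length_cons]; omega)
  unfold advectComm
  rw [torusInner_sum_left _ (fun j => SmoothPer.list_sum _ (hs j)) ((hz c').pdList l),
    Fin.sum_univ_two]
  have h0 := key 0
  have h1 := key 1
  refine (abs_add_le _ _).trans ?_
  linarith

/-- The combinatorial constant in the energy estimate of order `m`. -/
def energyConst (m : ℕ) : ℝ :=
  ∑ l : Fin m → Fin 2, 48 * ((leibnizPairs (List.ofFn l)).length : ℝ)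

variable {ν η : ℝ} {U B U' B' : Fin 2 → (Fin 2 → ℝ) → ℝ} {Q : (Fin 2 → ℝ) → ℝ}

theorem mhd_energy_le_of_list (hU : ∀ i, SmoothPer (U i)) (hB : ∀ i, SmoothPer (B i))
    (hQ : SmoothPer Q) (divU : ∀ x, ∑ j, pd j (U j) x = 0) (divB : ∀ x, ∑ j, pd j (B j) x = 0)
    (eU : ∀ i x, U' i x + advect U (U i) x + pd i Q x
      = ν * (∑ j, pd j (pd j (U i)) x) + advect B (B i) x)
    (eB : ∀ i x, B' i x + advect U (B i) x
      = advect B (U i) x + η * (∑ j, pd j (pd j (B i)) x)) (l : List (Fin 2)) :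
    (∑ i, torusInner (pdList l (U' i)) (pdList l (U i)))
      + (∑ i, torusInner (pdList l (B' i)) (pdList l (B i)))
      + ν * (∑ i, ∑ j, torusInt (fun x => pd j (pdList l (U i)) x ^ 2))
      + η * (∑ i, ∑ j, torusInt (fun x => pd j (pdList l (B i)) x ^ 2))
    ≤ 48 * (leibnizPairs l).length * √(gradEnergy 1 (Sum.elim U B)
        * gradEnergy l.length (Sum.elim U B) * gradEnergy (l.length + 1) (Sum.elim U B)) := by
  set z := Sum.elim U B with hzdef
  have hz : ∀ c, SmoothPer (z c) := by
    rintro (i | i)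
    exacts [hU i, hB i]
  have hLU : ∀ i, SmoothPer fun x => ∑ j, pd j (pd j (U i)) x :=
    fun i => SmoothPer.sum _ fun j _ => ((hU i).pd j).pd j
  have hLB : ∀ i, SmoothPer fun x => ∑ j, pd j (pd j (B i)) x :=
    fun i => SmoothPer.sum _ fun j _ => ((hB i).pd j).pd j
  have fU : ∀ i, torusInner (pdList l (U' i)) (pdList l (U i))
      = -(ν * ∑ j, torusInt (fun x => pd j (pdList l (U i)) x ^ 2))
        + (torusInner (advect B (pdList l (B i))) (pdList l (U i))
          + torusInner (advectComm l B (B i)) (pdList l (U i)))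
        - torusInner (advectComm l U (U i)) (pdList l (U i))
        - torusInner (pdList l (pd i Q)) (pdList l (U i)) := fun i => by
    have e : U' i = fun x => ν * (∑ j, pd j (pd j (U i)) x) + advect B (B i) x
        - advect U (U i) x - pd i Q x := by
      funext x
      linarith [eU i x]
    have s0 := torusInner_advect_left hU divU ((hU i).pdList l) ((hU i).pdList l)
    have s1 := (hLU i).const_mul ν
    have s2 := SmoothPer.advect hB (hB i)
    have s3 := SmoothPer.advect hU (hU i)
    have s4 := hQ.pd i
    have s5 := (hU i).pdList l
    rw [e, pdList_sub ((s1.add s2).sub s3) s4, pdList_sub (s1.add s2) s3, pdList_add s1 s2,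
      pdList_const_mul (hLU i),
      torusInner_sub_left ((((hLU i).pdList l).const_mul ν |>.add (s2.pdList l)).sub (s3.pdList l))
        (s4.pdList l) s5,
      torusInner_sub_left (((hLU i).pdList l).const_mul ν |>.add (s2.pdList l)) (s3.pdList l) s5,
      torusInner_add_left (((hLU i).pdList l).const_mul ν) (s2.pdList l) s5,
      torusInner_const_mul_left, torusInner_pdList_laplacian (hU i),
      pdList_advect hB (hB i), pdList_advect hU (hU i),
      torusInner_add_left (SmoothPer.advect hB ((hB i).pdList l))
        (SmoothPer.advectComm hB (hB i) l) s5,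
      torusInner_add_left (SmoothPer.advect hU ((hU i).pdList l))
        (SmoothPer.advectComm hU (hU i) l) s5]
    linarith
  have fB : ∀ i, torusInner (pdList l (B' i)) (pdList l (B i))
      = -(η * ∑ j, torusInt (fun x => pd j (pdList l (B i)) x ^ 2))
        + (-torusInner (advect B (pdList l (B i))) (pdList l (U i))
          + torusInner (advectComm l B (U i)) (pdList l (B i)))
        - torusInner (advectComm l U (B i)) (pdList l (B i)) := fun i => by
    have e : B' i = fun x => η * (∑ j, pd j (pd j (B i)) x) + advect B (U i) x
        - advect U (B i) x := by
      funext x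
      linarith [eB i x]
    have s0 := torusInner_advect_left hU divU ((hB i).pdList l) ((hB i).pdList l)
    have s0' := torusInner_advect_left hB divB ((hB i).pdList l) ((hU i).pdList l)
    have s1 := (hLB i).const_mul η
    have s2 := SmoothPer.advect hB (hU i)
    have s3 := SmoothPer.advect hU (hB i)
    have s5 := (hB i).pdList l
    rw [e, pdList_sub (s1.add s2) s3, pdList_add s1 s2,
      pdList_const_mul (hLB i),
      torusInner_sub_left (((hLB i).pdList l).const_mul η |>.add (s2.pdList l)) (s3.pdList l) s5,
      torusInner_add_left (((hLB i).pdList l).const_mul η) (s2.pdList l) s5,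
      torusInner_const_mul_left, torusInner_pdList_laplacian (hB i),
      pdList_advect hB (hU i), pdList_advect hU (hB i),
      torusInner_add_left (SmoothPer.advect hB ((hU i).pdList l))
        (SmoothPer.advectComm hB (hU i) l) s5,
      torusInner_add_left (SmoothPer.advect hU ((hB i).pdList l))
        (SmoothPer.advectComm hU (hB i) l) s5]
    linarith
  have hP := sum_torusInner_pdList_grad hU divU hQ l
  have b1 := fun i => abs_le.1 (abs_torusInner_advectComm_le hz Sum.inl (Sum.inl i) (Sum.inl i) l)
  have b2 := fun i => abs_le.1 (abs_torusInner_advectComm_le hz Sum.inr (Sum.inr i) (Sum.inl i) l)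
  have b3 := fun i => abs_le.1 (abs_torusInner_advectComm_le hz Sum.inl (Sum.inr i) (Sum.inr i) l)
  have b4 := fun i => abs_le.1 (abs_torusInner_advectComm_le hz Sum.inr (Sum.inl i) (Sum.inr i) l)
  simp only [hzdef, Sum.elim_inl, Sum.elim_inr] at b1 b2 b3 b4
  simp only [← hzdef] at b1 b2 b3 b4
  simp only [fU, fB]
  rw [Fin.sum_univ_two] at hP
  simp only [Fin.sum_univ_two (f := fun i => (_ : ℝ))]
  linarith [(b1 0).1, (b1 1).1, (b2 0).2, (b2 1).2, (b3 0).1, (b3 1).1, (b4 0).2, (b4 1).2]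

/-- The energy inequality of order `m` for the MHD system at a fixed time. -/
theorem mhd_energy_le (hU : ∀ i, SmoothPer (U i)) (hB : ∀ i, SmoothPer (B i))
    (hQ : SmoothPer Q) (divU : ∀ x, ∑ j, pd j (U j) x = 0) (divB : ∀ x, ∑ j, pd j (B j) x = 0)
    (eU : ∀ i x, U' i x + advect U (U i) x + pd i Q x
      = ν * (∑ j, pd j (pd j (U i)) x) + advect B (B i) x)
    (eB : ∀ i x, B' i x + advect U (B i) x
      = advect B (U i) x + η * (∑ j, pd j (pd j (B i)) x)) (m : ℕ) :
    (∑ i, ∑ l : Fin m → Fin 2,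
        torusInner (pdList (List.ofFn l) (U' i)) (pdList (List.ofFn l) (U i)))
      + (∑ i, ∑ l : Fin m → Fin 2,
        torusInner (pdList (List.ofFn l) (B' i)) (pdList (List.ofFn l) (B i)))
      + ν * gradEnergy (m + 1) U + η * gradEnergy (m + 1) B
    ≤ energyConst m * √(gradEnergy 1 (Sum.elim U B)
        * gradEnergy m (Sum.elim U B) * gradEnergy (m + 1) (Sum.elim U B)) := by
  have h := Finset.sum_le_sum fun l (_ : l ∈ (Finset.univ : Finset (Fin m → Fin 2))) =>
    mhd_energy_le_of_list hU hB hQ divU divB eU eB (List.ofFn l)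
  simp only [List.length_ofFn, Finset.sum_add_distrib, ← Finset.sum_mul, ← Finset.mul_sum] at h
  rw [energyConst, ← Finset.mul_sum, gradEnergy_succ m U, gradEnergy_succ m B]
  rw [Finset.sum_comm (s := Finset.univ (α := Fin 2)), Finset.sum_comm (s := Finset.univ (α := Fin 2)),
    Finset.sum_comm (s := Finset.univ (α := Fin 2)), Finset.sum_comm (s := Finset.univ (α := Fin 2))]
  exact h

end EnergyIdentity

/-- A time-dependent function, smooth up to time zero and periodic in space. -/
structure SmoothFlow {d : ℕ} (F : ℝ → (Fin d → ℝ) → ℝ) : Prop where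
  smooth : ContDiffOn ℝ (⊤ : ℕ∞) (fun p : ℝ × (Fin d → ℝ) => F p.1 p.2) (Ici 0 ×ˢ univ)
  per : ∀ t, 0 ≤ t → Prdc 1 (F t)

section

variable {d : ℕ} {F : ℝ → (Fin d → ℝ) → ℝ} {t : ℝ}

/-- The time derivative of a time-dependent function. -/
def dt (F : ℝ → (Fin d → ℝ) → ℝ) (t : ℝ) (x : Fin d → ℝ) : ℝ := deriv (fun s => F s x) t

namespace SmoothFlow

theorem at_time (hF : SmoothFlow F) (ht : 0 ≤ t) : SmoothPer (F t) := by
  refine ⟨?_, hF.per t ht⟩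
  have h : ContDiff ℝ (⊤ : ℕ∞) fun x : Fin d → ℝ => (t, x) := contDiff_const.prodMk contDiff_id
  exact contDiffOn_univ.1 (hF.smooth.comp h.contDiffOn fun x _ => ⟨ht, mem_univ _⟩)

theorem uniqueDiffOn : UniqueDiffOn ℝ (Ici (0 : ℝ) ×ˢ (univ : Set (Fin d → ℝ))) :=
  (uniqueDiffOn_Ici 0).prod uniqueDiffOn_univ

theorem pd_eq_fderivWithin (hF : SmoothFlow F) (ht : 0 ≤ t) (i : Fin d) (x : Fin d → ℝ) :
    pd i (F t) x = fderivWithin ℝ (fun p : ℝ × (Fin d → ℝ) => F p.1 p.2) (Ici 0 ×ˢ univ) (t, x)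
      (0, Pi.single i 1) := by
  have h1 := ((hF.smooth (t, x) ⟨ht, mem_univ _⟩).differentiableWithinAt
    (by simp)).hasFDerivWithinAt
  have h2 := h1.comp_hasFDerivAt x (hasFDerivAt_prodMk_right t x)
    (Filter.Eventually.of_forall fun y => ⟨ht, mem_univ _⟩)
  have h3 : HasFDerivAt (F t) _ x := h2
  rw [pd, h3.fderiv]
  rfl

protected theorem pd (hF : SmoothFlow F) (i : Fin d) : SmoothFlow fun t => pd i (F t) := by
  refine ⟨?_, fun t ht => ((hF.at_time ht).pd i).per⟩
  have h := (hF.smooth.fderivWithin uniqueDiffOn (m := (⊤ : ℕ∞)) (by simp)).clm_apply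
    (contDiffOn_const (c := ((0 : ℝ), (Pi.single i 1 : Fin d → ℝ))))
  exact h.congr fun p hp => hF.pd_eq_fderivWithin hp.1 i p.2

protected theorem pdList (hF : SmoothFlow F) (l : List (Fin d)) :
    SmoothFlow fun t => pdList l (F t) := by
  induction l with
  | nil => exact hF
  | cons i l ih => exact ih.pd i

protected theorem pow (hF : SmoothFlow F) (n : ℕ) : SmoothFlow fun t x => F t x ^ n :=
  ⟨hF.smooth.pow n, fun _ ht => ((hF.at_time ht).pow n).per⟩

theorem continuousOn_torusInt (hF : SmoothFlow F) :
    ContinuousOn (fun t => torusInt (F t)) (Ici 0) := by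
  have h : Continuous (fun p : ℝ × (Fin d → ℝ) => F (max p.1 0) p.2) :=
    continuousOn_univ.1 (hF.smooth.continuousOn.comp
      (f := fun p : ℝ × (Fin d → ℝ) => (max p.1 0, p.2)) (by fun_prop)
      fun p _ => ⟨mem_Ici.2 (le_max_right _ _), mem_univ _⟩)
  have h2 := continuous_parametric_integral_of_continuous (μ := volume)
    (f := fun t x => F (max t 0) x) h (isCompact_box d 1)
  refine h2.continuousOn.congr fun _ ht => ?_
  simp only [max_eq_left (mem_Ici.1 ht)]
  rfl

theorem contDiffAt (hF : SmoothFlow F) (ht : 0 < t) (x : Fin d → ℝ) :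
    ContDiffAt ℝ (⊤ : ℕ∞) (fun p : ℝ × (Fin d → ℝ) => F p.1 p.2) (t, x) :=
  hF.smooth.contDiffAt (prod_mem_nhds (Ici_mem_nhds ht) Filter.univ_mem)

theorem hasDerivAt_fderiv (hF : SmoothFlow F) (ht : 0 < t) (x : Fin d → ℝ) :
    HasDerivAt (fun s => F s x)
      (fderiv ℝ (fun p : ℝ × (Fin d → ℝ) => F p.1 p.2) (t, x) (1, 0)) t := by
  have h1 := ((hF.contDiffAt ht x).differentiableAt (by simp)).hasFDerivAt
  exact h1.comp_hasDerivAt (f := fun s : ℝ => (s, x)) t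
    ((hasDerivAt_id' t).prodMk (hasDerivAt_const t x))

theorem dt_eq_fderiv (hF : SmoothFlow F) (ht : 0 < t) (x : Fin d → ℝ) :
    dt F t x = fderiv ℝ (fun p : ℝ × (Fin d → ℝ) => F p.1 p.2) (t, x) (1, 0) :=
  (hF.hasDerivAt_fderiv ht x).deriv

theorem hasDerivAt (hF : SmoothFlow F) (ht : 0 < t) (x : Fin d → ℝ) :
    HasDerivAt (fun s => F s x) (dt F t x) t := by
  rw [hF.dt_eq_fderiv ht]
  exact hF.hasDerivAt_fderiv ht x

theorem pd_eq_fderiv (hF : SmoothFlow F) (ht : 0 < t) (i : Fin d) (x : Fin d → ℝ) :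
    pd i (F t) x
      = fderiv ℝ (fun p : ℝ × (Fin d → ℝ) => F p.1 p.2) (t, x) (0, Pi.single i 1) := by
  have h1 := ((hF.contDiffAt ht x).differentiableAt (by simp)).hasFDerivAt
  have h3 : HasFDerivAt (F t) _ x := h1.comp x (hasFDerivAt_prodMk_right t x)
  rw [pd, h3.fderiv]
  rfl

theorem contDiffOn_fderiv (hF : SmoothFlow F) :
    ContDiffOn ℝ (⊤ : ℕ∞) (fderiv ℝ fun p : ℝ × (Fin d → ℝ) => F p.1 p.2)
      (Ioi 0 ×ˢ univ) :=
  (hF.smooth.mono (prod_mono Ioi_subset_Ici_self subset_rfl)).fderiv_of_isOpen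
    (isOpen_Ioi.prod isOpen_univ) (by simp)

theorem dt_pd (hF : SmoothFlow F) (ht : 0 < t) (i : Fin d) :
    dt (fun s => pd i (F s)) t = pd i (dt F t) := by
  funext x
  set H : ℝ × (Fin d → ℝ) → ℝ := fun p => F p.1 p.2 with hH
  have hD : HasFDerivAt (fderiv ℝ H) (fderiv ℝ (fderiv ℝ H) (t, x)) (t, x) :=
    ((hF.contDiffOn_fderiv.contDiffAt
      (prod_mem_nhds (Ioi_mem_nhds ht) Filter.univ_mem)).differentiableAt (by simp)).hasFDerivAt
  have h1 : HasDerivAt (fun s => pd i (F s) x)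
      (fderiv ℝ (fderiv ℝ H) (t, x) (1, 0) (0, Pi.single i 1)) t := by
    have h := (hD.comp_hasDerivAt (f := fun s : ℝ => (s, x)) t
      ((hasDerivAt_id' t).prodMk (hasDerivAt_const t x))).clm_apply
      (hasDerivAt_const t ((0 : ℝ), (Pi.single i 1 : Fin d → ℝ)))
    simp only [map_zero, add_zero] at h
    refine h.congr_of_eventuallyEq ?_
    filter_upwards [Ioi_mem_nhds ht] with s hs
    exact hF.pd_eq_fderiv hs i x
  have h2 : HasFDerivAt (dt F t) _ x :=
    ((hD.comp x (hasFDerivAt_prodMk_right t x)).clm_apply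
      (hasFDerivAt_const ((1 : ℝ), (0 : Fin d → ℝ)) x)).congr_of_eventuallyEq
      (Filter.Eventually.of_forall fun y => hF.dt_eq_fderiv ht y)
  have hs := (hF.contDiffAt ht x).isSymmSndFDerivAt
    (by simpa using WithTop.coe_le_coe.2 (le_top : (2 : ℕ∞) ≤ ⊤))
  rw [dt, h1.deriv, pd, h2.fderiv, hs.eq]
  simp [hH]

theorem dt_pdList (hF : SmoothFlow F) (ht : 0 < t) (l : List (Fin d)) :
    dt (fun s => pdList l (F s)) t = pdList l (dt F t) := by
  induction l with
  | nil => rfl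
  | cons i l ih => simp only [pdList, (hF.pdList l).dt_pd ht i, ih]

theorem dt_sq (hF : SmoothFlow F) (ht : 0 < t) :
    dt (fun s x => F s x ^ 2) t = fun x => 2 * (dt F t x * F t x) := by
  funext x
  rw [dt, ((hF.hasDerivAt ht x).fun_pow 2).deriv]
  push_cast
  ring

theorem continuousOn_dt (hF : SmoothFlow F) :
    ContinuousOn (fun p : ℝ × (Fin d → ℝ) => dt F p.1 p.2) (Ioi 0 ×ˢ univ) :=
  (hF.contDiffOn_fderiv.continuousOn.clm_apply continuousOn_const).congr
    fun p hp => hF.dt_eq_fderiv hp.1 p.2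

theorem hasDerivAt_torusInt (hF : SmoothFlow F) (ht : 0 < t) :
    HasDerivAt (fun s => torusInt (F s)) (torusInt (dt F t)) t := by
  have hK : IsCompact (Icc (t / 2) (t + 1) ×ˢ box d 1) := isCompact_Icc.prod (isCompact_box d 1)
  have hsub : Icc (t / 2) (t + 1) ⊆ Ioi 0 := fun s hs => lt_of_lt_of_le (by linarith) hs.1
  obtain ⟨M, hM⟩ := hK.exists_bound_of_continuousOn
    (hF.continuousOn_dt.mono (prod_mono hsub (subset_univ _)))
  have hdt : ContinuousOn (dt F t) (box d 1) :=
    hF.continuousOn_dt.comp (f := fun x : Fin d → ℝ => (t, x)) (by fun_prop)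
      fun x _ => ⟨ht, mem_univ _⟩
  have hmeas : MeasurableSet (box d 1) := (isCompact_box d 1).measurableSet
  refine (hasDerivAt_integral_of_dominated_loc_of_deriv_le (bound := fun _ => M)
    (s := Icc (t / 2) (t + 1)) (F' := dt F)
    (Icc_mem_nhds (by linarith) (by linarith)) ?_
    (hF.at_time ht.le).continuous.integrableOn_box
    (hdt.aestronglyMeasurable hmeas) ?_ ?_ ?_).2
  · filter_upwards [Ioi_mem_nhds ht] with s hs
    exact (hF.at_time (le_of_lt hs)).continuous.aestronglyMeasurable
  · exact (ae_restrict_mem hmeas).mono fun x hx s hs => hM (s, x) ⟨hs, hx⟩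
  · exact integrableOn_const (isCompact_box d 1).measure_ne_top
  · exact Filter.Eventually.of_forall fun x s hs => hF.hasDerivAt (hsub hs) x

theorem hasDerivAt_torusInt_sq (hF : SmoothFlow F) (ht : 0 < t) (l : List (Fin d)) :
    HasDerivAt (fun s => torusInt fun x => pdList l (F s) x ^ 2)
      (2 * torusInner (pdList l (dt F t)) (pdList l (F t))) t := by
  have h := ((hF.pdList l).pow 2).hasDerivAt_torusInt ht
  rwa [(hF.pdList l).dt_sq ht, hF.dt_pdList ht, torusInt_const_mul] at h

end SmoothFlow

end

section

variable {ι : Type*} [Fintype ι] {Z : ι → ℝ → (Fin 2 → ℝ) → ℝ} {t : ℝ}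

theorem continuousOn_gradEnergy (hZ : ∀ c, SmoothFlow (Z c)) (k : ℕ) :
    ContinuousOn (fun t => gradEnergy k fun c => Z c t) (Ici 0) :=
  continuousOn_finsetSum _ fun c _ => continuousOn_finsetSum _ fun l _ =>
    (((hZ c).pdList (List.ofFn l)).pow 2).continuousOn_torusInt

theorem hasDerivAt_gradEnergy (hZ : ∀ c, SmoothFlow (Z c)) (ht : 0 < t) (k : ℕ) :
    HasDerivAt (fun t => gradEnergy k fun c => Z c t)
      (2 * ∑ c, ∑ l : Fin k → Fin 2, torusInner (pdList (List.ofFn l) (dt (Z c) t))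
        (pdList (List.ofFn l) (Z c t))) t := by
  simp only [Finset.mul_sum]
  exact HasDerivAt.fun_sum fun c _ => HasDerivAt.fun_sum fun l _ =>
    (hZ c).hasDerivAt_torusInt_sq ht (List.ofFn l)

end

theorem add_integral_le_mul_exp {f f' g D : ℝ → ℝ} {K : ℝ} (hK : 0 ≤ K)
    (hf : ContinuousOn f (Ici 0)) (hg : ContinuousOn g (Ici 0)) (hD : ContinuousOn D (Ici 0))
    (g0 : ∀ t, 0 ≤ t → 0 ≤ g t) (D0 : ∀ t, 0 ≤ t → 0 ≤ D t)
    (hderiv : ∀ t, 0 < t → HasDerivAt f (f' t) t)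
    (hle : ∀ t, 0 < t → f' t + D t ≤ K * g t * f t) {t : ℝ} (ht : 0 ≤ t) :
    f t + ∫ s in (0 : ℝ)..t, D s ≤ f 0 * exp (K * ∫ s in (0 : ℝ)..t, g s) := by
  have ext : ∀ {φ : ℝ → ℝ}, ContinuousOn φ (Ici 0) → Continuous fun s => φ (max s 0) :=
    fun hφ => continuousOn_univ.1 (hφ.comp (f := fun s : ℝ => max s 0) (by fun_prop)
      fun s _ => mem_Ici.2 (le_max_right s 0))
  have extInt : ∀ (φ : ℝ → ℝ) {s : ℝ}, 0 ≤ s →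
      ∫ y in (0 : ℝ)..s, φ y = ∫ y in (0 : ℝ)..s, φ (max y 0) := fun φ s hs => by
    refine intervalIntegral.integral_congr fun y hy => ?_
    rw [uIcc_of_le hs] at hy
    simp only [max_eq_left hy.1]
  have hG : ∀ s, HasDerivAt (fun s => ∫ y in (0 : ℝ)..s, g (max y 0)) (g (max s 0)) s :=
    fun s => (ext hg).integral_hasStrictDerivAt 0 s |>.hasDerivAt
  have hI : ∀ s, HasDerivAt (fun s => ∫ y in (0 : ℝ)..s, D (max y 0)) (D (max s 0)) s :=
    fun s => (ext hD).integral_hasStrictDerivAt 0 s |>.hasDerivAt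
  rw [extInt g ht, extInt D ht]
  set G : ℝ → ℝ := fun s => ∫ y in (0 : ℝ)..s, g (max y 0) with hGdef
  set I : ℝ → ℝ := fun s => ∫ y in (0 : ℝ)..s, D (max y 0) with hIdef
  have hI0 : ∀ s, 0 ≤ s → 0 ≤ I s := fun s hs =>
    intervalIntegral.integral_nonneg hs fun y _ => D0 _ (le_max_right _ _)
  have hh : ∀ s, 0 < s → HasDerivAt (fun s => (f s + I s) * exp (-(K * G s)))
      ((f' s + D s) * exp (-(K * G s)) + (f s + I s) * (exp (-(K * G s)) * -(K * g s))) s :=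
    fun s hs => by
      have h1 := hG s
      have h2 := hI s
      rw [max_eq_left hs.le] at h1 h2
      exact ((hderiv s hs).add h2).mul ((h1.const_mul K).neg.exp)
  have hanti : AntitoneOn (fun s => (f s + I s) * exp (-(K * G s))) (Ici 0) := by
    have hGc : Continuous G := continuous_iff_continuousAt.2 fun s => (hG s).continuousAt
    have hIc : Continuous I := continuous_iff_continuousAt.2 fun s => (hI s).continuousAt
    refine antitoneOn_of_deriv_nonpos (convex_Ici 0) ?_ ?_ ?_
    · exact (hf.add hIc.continuousOn).mul
        (Continuous.continuousOn (by fun_prop))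
    · rw [interior_Ici]
      exact fun s hs => (hh s hs).differentiableAt.differentiableWithinAt
    · rw [interior_Ici]
      intro s hs
      rw [(hh s hs).deriv]
      have h1 := hle s hs
      have h2 : 0 ≤ K * g s * I s := mul_nonneg (mul_nonneg hK (g0 s (le_of_lt hs)))
        (hI0 s (le_of_lt hs))
      have h3 := exp_pos (-(K * G s))
      have h4 : (f' s + D s - K * g s * f s - K * g s * I s) * exp (-(K * G s)) ≤ 0 :=
        mul_nonpos_of_nonpos_of_nonneg (by linarith) h3.le
      linarith
  have h := hanti (mem_Ici.2 le_rfl) (mem_Ici.2 ht) ht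
  have hG0 : G 0 = 0 := intervalIntegral.integral_same
  have hI00 : I 0 = 0 := intervalIntegral.integral_same
  simp only [hG0, hI00, mul_zero, neg_zero, exp_zero, add_zero, mul_one] at h
  rwa [exp_neg, ← div_eq_mul_inv, div_le_iff₀ (exp_pos _)] at h

theorem two_mul_mul_sqrt_le {K X Y δ : ℝ} (hX : 0 ≤ X) (hY : 0 ≤ Y) (hδ : 0 < δ) :
    2 * (K * √(X * Y)) ≤ δ * Y + K ^ 2 / δ * X := by
  rw [Real.sqrt_mul hX]
  have hx := Real.sq_sqrt hX
  have hy := Real.sq_sqrt hY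
  have h := sq_nonneg (δ * √Y - K * √X)
  have e : δ * Y + K ^ 2 / δ * X - 2 * (K * (√X * √Y)) = (δ * √Y - K * √X) ^ 2 / δ := by
    rw [← hx, ← hy]
    simp only [Real.sqrt_sq (Real.sqrt_nonneg _)]
    field_simp
    ring
  have := div_nonneg h hδ.le
  linarith

namespace IsMHD

variable {ν η : ℝ} {u b : ℝ → (Fin 2 → ℝ) → Fin 2 → ℝ} {P : ℝ → (Fin 2 → ℝ) → ℝ} {t : ℝ}

theorem smoothFlow_u (h : IsMHD 2 1 ν η (Ici 0) u b P) (i : Fin 2) :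
    SmoothFlow fun t x => u t x i :=
  ⟨contDiffOn_pi.1 h.smooth_u i, fun t ht x j => congrFun (h.periodic_u t ht x j) i⟩

theorem smoothFlow_b (h : IsMHD 2 1 ν η (Ici 0) u b P) (i : Fin 2) :
    SmoothFlow fun t x => b t x i :=
  ⟨contDiffOn_pi.1 h.smooth_b i, fun t ht x j => congrFun (h.periodic_b t ht x j) i⟩

theorem smoothFlow_P (h : IsMHD 2 1 ν η (Ici 0) u b P) : SmoothFlow P :=
  ⟨h.smooth_P, h.periodic_P⟩

end IsMHD

/-- The components of a time-dependent vector field at a given time. -/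
def comps (w : ℝ → (Fin 2 → ℝ) → Fin 2 → ℝ) (t : ℝ) (i : Fin 2) (x : Fin 2 → ℝ) : ℝ := w t x i

/-- The components of the velocity and of the magnetic field at a given time. -/
def mhdComps (u b : ℝ → (Fin 2 → ℝ) → Fin 2 → ℝ) (t : ℝ) : Fin 2 ⊕ Fin 2 → (Fin 2 → ℝ) → ℝ :=
  Sum.elim (comps u t) (comps b t)

/-- The dissipation of the energy of order `m - 1`. -/
def dissipation (ν η : ℝ) (u b : ℝ → (Fin 2 → ℝ) → Fin 2 → ℝ) (m : ℕ) (t : ℝ) : ℝ :=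
  ν * gradEnergy m (comps u t) + η * gradEnergy m (comps b t)

theorem torusInt_advect {v : Fin 2 → (Fin 2 → ℝ) → ℝ} {f : (Fin 2 → ℝ) → ℝ}
    (hv : ∀ j, SmoothPer (v j)) (hdiv : ∀ x, ∑ j, pd j (v j) x = 0) (hf : SmoothPer f) :
    torusInt (advect v f) = 0 := by
  have h1 : SmoothPer fun _ : Fin 2 → ℝ => (1 : ℝ) := ⟨contDiff_const, fun _ _ => rfl⟩
  have h := torusInner_advect_left hv hdiv hf h1
  have e : advect v (fun _ : Fin 2 → ℝ => (1 : ℝ)) = fun _ => 0 := by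
    funext x
    simp [advect, pd]
  rw [e] at h
  simpa [torusInner, torusInt_zero] using h

namespace IsMHD

variable {ν η : ℝ} {u b : ℝ → (Fin 2 → ℝ) → Fin 2 → ℝ} {P : ℝ → (Fin 2 → ℝ) → ℝ} {t : ℝ}

theorem smoothPer_comps_u (h : IsMHD 2 1 ν η (Ici 0) u b P) (ht : 0 ≤ t) (i : Fin 2) :
    SmoothPer (comps u t i) := (h.smoothFlow_u i).at_time ht

theorem smoothPer_comps_b (h : IsMHD 2 1 ν η (Ici 0) u b P) (ht : 0 ≤ t) (i : Fin 2) :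
    SmoothPer (comps b t i) := (h.smoothFlow_b i).at_time ht

theorem smoothPer_mhdComps (h : IsMHD 2 1 ν η (Ici 0) u b P) (ht : 0 ≤ t)
    (c : Fin 2 ⊕ Fin 2) : SmoothPer (mhdComps u b t c) := by
  rcases c with i | i
  exacts [h.smoothPer_comps_u ht i, h.smoothPer_comps_b ht i]

theorem momentum_comps (h : IsMHD 2 1 ν η (Ici 0) u b P) (ht : 0 < t) (i : Fin 2)
    (x : Fin 2 → ℝ) :
    dt (fun s y => u s y i) t x + advect (comps u t) (comps u t i) x + pd i (P t) x
      = ν * (∑ j, pd j (pd j (comps u t i)) x) + advect (comps b t) (comps b t i) x :=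
  h.momentum t ht.le ht x i

theorem induction_comps (h : IsMHD 2 1 ν η (Ici 0) u b P) (ht : 0 < t) (i : Fin 2)
    (x : Fin 2 → ℝ) :
    dt (fun s y => b s y i) t x + advect (comps u t) (comps b t i) x
      = advect (comps b t) (comps u t i) x + η * (∑ j, pd j (pd j (comps b t i)) x) :=
  h.induction_eq t ht.le ht x i

theorem torusInt_dt_u (h : IsMHD 2 1 ν η (Ici 0) u b P) (ht : 0 < t) (i : Fin 2) :
    torusInt (dt (fun s y => u s y i) t) = 0 := by
  have hu := h.smoothPer_comps_u ht.le
  have hb := h.smoothPer_comps_b ht.le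
  have hL : SmoothPer fun x => ∑ j, pd j (pd j (comps u t i)) x :=
    SmoothPer.sum _ fun j _ => ((hu i).pd j).pd j
  have e : dt (fun s y => u s y i) t = fun x => ν * (∑ j, pd j (pd j (comps u t i)) x)
      + advect (comps b t) (comps b t i) x - advect (comps u t) (comps u t i) x
      - pd i (P t) x := by
    funext x
    linarith [h.momentum_comps ht i x]
  have s1 := hL.const_mul ν
  have s2 := SmoothPer.advect hb (hb i)
  have s3 := SmoothPer.advect hu (hu i)
  have s4 := ((h.smoothFlow_P).at_time ht.le).pd i
  rw [e, torusInt_sub ((s1.add s2).sub s3).continuous s4.continuous,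
    torusInt_sub (s1.add s2).continuous s3.continuous, torusInt_add s1.continuous s2.continuous,
    torusInt_const_mul, torusInt_sum _ fun j _ => (((hu i).pd j).pd j).continuous,
    torusInt_advect hb (h.div_b t ht.le) (hb i), torusInt_advect hu (h.div_u t ht.le) (hu i),
    torusInt_pd ((h.smoothFlow_P).at_time ht.le)]
  simp [fun j => torusInt_pd ((hu i).pd j) j]

theorem torusInt_dt_b (h : IsMHD 2 1 ν η (Ici 0) u b P) (ht : 0 < t) (i : Fin 2) :
    torusInt (dt (fun s y => b s y i) t) = 0 := by
  have hu := h.smoothPer_comps_u ht.le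
  have hb := h.smoothPer_comps_b ht.le
  have hL : SmoothPer fun x => ∑ j, pd j (pd j (comps b t i)) x :=
    SmoothPer.sum _ fun j _ => ((hb i).pd j).pd j
  have e : dt (fun s y => b s y i) t = fun x => advect (comps b t) (comps u t i) x
      + η * (∑ j, pd j (pd j (comps b t i)) x) - advect (comps u t) (comps b t i) x := by
    funext x
    linarith [h.induction_comps ht i x]
  have s1 := hL.const_mul η
  have s2 := SmoothPer.advect hb (hu i)
  have s3 := SmoothPer.advect hu (hb i)
  rw [e, torusInt_sub (s2.add s1).continuous s3.continuous, torusInt_add s2.continuous s1.continuous,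
    torusInt_const_mul, torusInt_sum _ fun j _ => (((hb i).pd j).pd j).continuous,
    torusInt_advect hb (h.div_b t ht.le) (hu i), torusInt_advect hu (h.div_u t ht.le) (hb i)]
  simp [fun j => torusInt_pd ((hb i).pd j) j]

end IsMHD

theorem torusInt_eq_zero_of_dt {F : ℝ → (Fin 2 → ℝ) → ℝ} (hF : SmoothFlow F)
    (h0 : torusInt (F 0) = 0) (hdt : ∀ t, 0 < t → torusInt (dt F t) = 0) {t : ℝ} (ht : 0 ≤ t) :
    torusInt (F t) = 0 := by
  have h := add_integral_le_mul_exp (K := 0) (g := fun _ => 0) (D := fun _ => 0) le_rfl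
    (hF.continuousOn_torusInt.pow 2) continuousOn_const continuousOn_const
    (fun _ _ => le_rfl) (fun _ _ => le_rfl)
    (fun t ht => (hF.hasDerivAt_torusInt ht).pow 2) (fun t ht => by simp [hdt t ht]) ht
  simp only [Pi.pow_apply, h0, intervalIntegral.integral_zero] at h
  nlinarith [sq_nonneg (torusInt (F t))]

namespace IsMHD

variable {ν η : ℝ} {u b : ℝ → (Fin 2 → ℝ) → Fin 2 → ℝ} {P : ℝ → (Fin 2 → ℝ) → ℝ} {t : ℝ}

theorem torusInt_mhdComps (h : IsMHD 2 1 ν η (Ici 0) u b P) (hu : ZeroAvg 1 (u 0))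
    (hb : ZeroAvg 1 (b 0)) (ht : 0 ≤ t) (c : Fin 2 ⊕ Fin 2) :
    torusInt (mhdComps u b t c) = 0 := by
  rcases c with i | i
  · exact torusInt_eq_zero_of_dt (h.smoothFlow_u i) (hu i) (fun t ht => h.torusInt_dt_u ht i) ht
  · exact torusInt_eq_zero_of_dt (h.smoothFlow_b i) (hb i) (fun t ht => h.torusInt_dt_b ht i) ht

theorem continuousOn_energy_u (h : IsMHD 2 1 ν η (Ici 0) u b P) (m : ℕ) :
    ContinuousOn (fun t => gradEnergy m (comps u t)) (Ici 0) :=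
  continuousOn_gradEnergy h.smoothFlow_u m

theorem continuousOn_energy_b (h : IsMHD 2 1 ν η (Ici 0) u b P) (m : ℕ) :
    ContinuousOn (fun t => gradEnergy m (comps b t)) (Ici 0) :=
  continuousOn_gradEnergy h.smoothFlow_b m

theorem continuousOn_energy (h : IsMHD 2 1 ν η (Ici 0) u b P) (m : ℕ) :
    ContinuousOn (fun t => gradEnergy m (mhdComps u b t)) (Ici 0) := by
  simp only [mhdComps, gradEnergy_sum_elim]
  exact (h.continuousOn_energy_u m).add (h.continuousOn_energy_b m)

theorem continuousOn_dissipation (h : IsMHD 2 1 ν η (Ici 0) u b P) (m : ℕ) :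
    ContinuousOn (dissipation ν η u b m) (Ici 0) :=
  ((h.continuousOn_energy_u m).const_smul ν).add ((h.continuousOn_energy_b m).const_smul η)

/-- The differential inequality satisfied by the energy of order `m`. -/
theorem exists_hasDerivAt_energy (h : IsMHD 2 1 ν η (Ici 0) u b P) (m : ℕ) :
    ∃ e' : ℝ → ℝ, ∀ t, 0 < t → HasDerivAt (fun t => gradEnergy m (mhdComps u b t)) (e' t) t ∧
      e' t + 2 * dissipation ν η u b (m + 1) t
        ≤ 2 * (energyConst m * √(gradEnergy 1 (mhdComps u b t) * gradEnergy m (mhdComps u b t)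
          * gradEnergy (m + 1) (mhdComps u b t))) := by
  refine ⟨fun t =>
    2 * (∑ i, ∑ l : Fin m → Fin 2, torusInner (pdList (List.ofFn l) (dt (fun s y => u s y i) t))
      (pdList (List.ofFn l) (comps u t i)))
    + 2 * (∑ i, ∑ l : Fin m → Fin 2, torusInner (pdList (List.ofFn l) (dt (fun s y => b s y i) t))
      (pdList (List.ofFn l) (comps b t i))), fun t ht => ⟨?_, ?_⟩⟩
  · simp only [mhdComps, gradEnergy_sum_elim]
    exact (hasDerivAt_gradEnergy h.smoothFlow_u ht m).add
      (hasDerivAt_gradEnergy h.smoothFlow_b ht m)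
  · have key := mhd_energy_le (h.smoothPer_comps_u ht.le) (h.smoothPer_comps_b ht.le)
      (h.smoothFlow_P.at_time ht.le) (h.div_u t ht.le) (h.div_b t ht.le)
      (h.momentum_comps ht) (h.induction_comps ht) m
    unfold dissipation mhdComps
    linarith

theorem mul_energy_le_dissipation {σ : ℝ} (hσ : σ < min ν η) (m : ℕ) :
    σ * gradEnergy m (mhdComps u b t) ≤ dissipation ν η u b m t := by
  rw [mhdComps, gradEnergy_sum_elim, dissipation]
  nlinarith [gradEnergy_nonneg m (comps u t), gradEnergy_nonneg m (comps b t),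
    hσ.le.trans (min_le_left ν η), hσ.le.trans (min_le_right ν η)]

theorem dissipation_nonneg (hν : 0 < ν) (hη : 0 < η) (m : ℕ) : 0 ≤ dissipation ν η u b m t :=
  add_nonneg (mul_nonneg hν.le (gradEnergy_nonneg _ _)) (mul_nonneg hη.le (gradEnergy_nonneg _ _))

end IsMHD

namespace IsMHD

variable {σ κ ν η : ℝ} {u b : ℝ → (Fin 2 → ℝ) → Fin 2 → ℝ} {P : ℝ → (Fin 2 → ℝ) → ℝ} {t : ℝ}

theorem energyConst_zero : energyConst 0 = 0 := by
  simp [energyConst, leibnizPairs]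

theorem integral_energy_one_le (h : IsMHD 2 1 ν η (Ici 0) u b P) (hσ : 0 < σ)
    (hσm : σ < min ν η) (ht : 0 ≤ t) :
    ∫ s in (0 : ℝ)..t, gradEnergy 1 (mhdComps u b s)
      ≤ gradEnergy 0 (mhdComps u b 0) / (2 * σ) := by
  have hν : 0 < ν := hσ.trans (hσm.trans_le (min_le_left _ _))
  have hη : 0 < η := hσ.trans (hσm.trans_le (min_le_right _ _))
  obtain ⟨e', he⟩ := h.exists_hasDerivAt_energy 0
  have key := add_integral_le_mul_exp (K := 0) (g := fun _ => 0)
    (D := fun t => 2 * σ * gradEnergy 1 (mhdComps u b t)) le_rfl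
    (h.continuousOn_energy 0) continuousOn_const ((h.continuousOn_energy 1).const_smul (2 * σ))
    (fun _ _ => le_rfl)
    (fun t _ => mul_nonneg (by positivity) (gradEnergy_nonneg _ _)) (fun t ht => (he t ht).1)
    (fun t ht => by
      have h1 := (he t ht).2
      have h2 := mul_energy_le_dissipation (u := u) (b := b) (t := t) hσm 1
      rw [energyConst_zero, zero_mul, mul_zero, zero_add] at h1
      linarith) ht
  rw [intervalIntegral.integral_const_mul, zero_mul, exp_zero, mul_one] at key
  have := gradEnergy_nonneg 0 (mhdComps u b t)
  rw [le_div_iff₀ (by positivity)]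
  linarith

theorem energy_add_dissipation_le (h : IsMHD 2 1 ν η (Ici 0) u b P) (hσ : 0 < σ)
    (hσm : σ < min ν η) (hκ0 : 0 < κ) (hκ2 : κ < 2) (m : ℕ) (ht : 0 ≤ t) :
    gradEnergy m (mhdComps u b t) + κ * ∫ s in (0 : ℝ)..t, dissipation ν η u b (m + 1) s
      ≤ gradEnergy m (mhdComps u b 0) * exp (energyConst m ^ 2 / (2 * (2 - κ))
        * gradEnergy 0 (mhdComps u b 0) / σ ^ 2) := by
  have hν : 0 < ν := hσ.trans (hσm.trans_le (min_le_left _ _))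
  have hη : 0 < η := hσ.trans (hσm.trans_le (min_le_right _ _))
  have hδ : 0 < (2 - κ) * σ := mul_pos (by linarith) hσ
  have hE := fun k s => gradEnergy_nonneg k (mhdComps u b s)
  have hK : 0 ≤ energyConst m ^ 2 / ((2 - κ) * σ) := by positivity
  obtain ⟨e', he⟩ := h.exists_hasDerivAt_energy m
  have key := add_integral_le_mul_exp (K := energyConst m ^ 2 / ((2 - κ) * σ))
    (g := fun t => gradEnergy 1 (mhdComps u b t))
    (D := fun t => κ * dissipation ν η u b (m + 1) t) hK
    (h.continuousOn_energy m) (h.continuousOn_energy 1)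
    ((h.continuousOn_dissipation (m + 1)).const_smul κ)
    (fun t _ => hE 1 t)
    (fun t _ => mul_nonneg hκ0.le (dissipation_nonneg hν hη (m + 1))) (fun t ht => (he t ht).1)
    (fun t ht => by
      have h1 := (he t ht).2
      have h2 := mul_energy_le_dissipation (u := u) (b := b) (t := t) hσm (m + 1)
      have h3 := two_mul_mul_sqrt_le (K := energyConst m) (mul_nonneg (hE 1 t) (hE m t))
        (hE (m + 1) t) hδ
      have h4 := mul_le_mul_of_nonneg_left h2 (show 0 ≤ 2 - κ by linarith)
      linarith) ht
  rw [intervalIntegral.integral_const_mul] at key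
  refine key.trans (mul_le_mul_of_nonneg_left (exp_le_exp.2 ?_) (hE m 0))
  refine (mul_le_mul_of_nonneg_left (h.integral_energy_one_le hσ hσm ht) hK).trans_eq ?_
  have : 2 - κ ≠ 0 := by linarith
  field_simp

theorem energy_le_exp_neg (h : IsMHD 2 1 ν η (Ici 0) u b P) (hu : ZeroAvg 1 (u 0))
    (hb : ZeroAvg 1 (b 0)) (hσ : 0 < σ) (hσm : σ < min ν η) (m : ℕ) (ht : 0 ≤ t) :
    gradEnergy m (mhdComps u b t)
      ≤ gradEnergy m (mhdComps u b 0) * exp (-(2 * σ) * t) * exp (energyConst m ^ 2 / 2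
        * gradEnergy 0 (mhdComps u b 0) / σ ^ 2) := by
  have hE := fun k s => gradEnergy_nonneg k (mhdComps u b s)
  have hK : 0 ≤ energyConst m ^ 2 / σ := by positivity
  obtain ⟨e', he⟩ := h.exists_hasDerivAt_energy m
  have key := add_integral_le_mul_exp (K := energyConst m ^ 2 / σ)
    (f := fun t => gradEnergy m (mhdComps u b t) * exp (2 * σ * t))
    (g := fun t => gradEnergy 1 (mhdComps u b t))
    (D := fun _ => 0) hK
    ((h.continuousOn_energy m).mul (Continuous.continuousOn (by fun_prop)))
    (h.continuousOn_energy 1) continuousOn_const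
    (fun t _ => hE 1 t) (fun _ _ => le_rfl)
    (fun t ht => (he t ht).1.mul (((hasDerivAt_id' t).const_mul (2 * σ)).exp))
    (fun t ht => by
      have h1 := (he t ht).2
      have h2 := mul_energy_le_dissipation (u := u) (b := b) (t := t) hσm (m + 1)
      have h3 := two_mul_mul_sqrt_le (K := energyConst m) (mul_nonneg (hE 1 t) (hE m t))
        (hE (m + 1) t) hσ
      have h4 := mul_le_mul_of_nonneg_left (two_mul_gradEnergy_le
        (h.smoothPer_mhdComps ht.le) (h.torusInt_mhdComps hu hb ht.le) m) hσ.le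
      have h5 : 0 ≤ (energyConst m ^ 2 / σ * gradEnergy 1 (mhdComps u b t)
          * gradEnergy m (mhdComps u b t) - (e' t + 2 * σ * gradEnergy m (mhdComps u b t)))
          * exp (2 * σ * t) := mul_nonneg (by linarith) (exp_pos _).le
      linarith) ht
  simp only [intervalIntegral.integral_zero, add_zero, mul_zero, exp_zero, mul_one] at key
  rw [neg_mul, exp_neg, mul_right_comm, ← div_eq_mul_inv, le_div_iff₀ (exp_pos _)]
  refine key.trans (mul_le_mul_of_nonneg_left (exp_le_exp.2 ?_) (hE m 0))
  refine (mul_le_mul_of_nonneg_left (h.integral_energy_one_le hσ hσm ht) hK).trans_eq ?_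
  field_simp

end IsMHD

section MultiIndex

theorem mIdxList_two (α : Fin 2 → ℕ) :
    mIdxList α = List.replicate (α 0) 0 ++ List.replicate (α 1) 1 := by
  simp [mIdxList, List.finRange_succ]

theorem count_mIdxList (α : Fin 2 → ℕ) (i : Fin 2) : (mIdxList α).count i = α i := by
  rw [mIdxList_two]
  fin_cases i <;> simp [List.count_replicate]

theorem length_mIdxList {m : ℕ} {α : Fin 2 → ℕ} (hα : α ∈ Finset.Nat.antidiagonalTuple 2 m) :
    (mIdxList α).length = m := by
  rw [Finset.Nat.mem_antidiagonalTuple, Fin.sum_univ_two] at hα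
  simp [mIdxList_two, hα]

theorem length_eq_sum_count (l : List (Fin 2)) : l.length = ∑ i, l.count i := by
  induction l with
  | nil => simp
  | cons a l ih =>
    simp only [List.length_cons, ih, List.count_cons, Fin.sum_univ_two]
    fin_cases a <;> simp <;> omega

theorem sum_mIdxList_le (m : ℕ) {F : List (Fin 2) → ℝ} (hF : ∀ l, 0 ≤ F l) :
    ∑ α ∈ Finset.Nat.antidiagonalTuple 2 m, F (mIdxList α)
      ≤ ∑ l : Fin m → Fin 2, F (List.ofFn l) := by
  classical
  choose! φ hφ using fun α (hα : α ∈ Finset.Nat.antidiagonalTuple 2 m) =>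
    exists_ofFn_eq (length_mIdxList hα)
  have hinj : Set.InjOn φ (Finset.Nat.antidiagonalTuple 2 m : Set (Fin 2 → ℕ)) := by
    intro α hα β hβ hab
    funext i
    rw [← count_mIdxList α, ← count_mIdxList β, ← hφ α hα, ← hφ β hβ, hab]
  rw [Finset.sum_congr rfl fun α hα => by rw [← hφ α hα],
    ← Finset.sum_image (f := fun l : Fin m → Fin 2 => F (List.ofFn l)) hinj]
  exact Finset.sum_le_univ_sum_of_nonneg fun _ => hF _

theorem sum_ofFn_le (m : ℕ) {F : List (Fin 2) → ℝ} (hF : ∀ l, 0 ≤ F l)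
    (hperm : ∀ l l', l.Perm l' → F l = F l') :
    ∑ l : Fin m → Fin 2, F (List.ofFn l)
      ≤ 2 ^ m * ∑ α ∈ Finset.Nat.antidiagonalTuple 2 m, F (mIdxList α) := by
  have key : ∀ l ∈ (Finset.univ : Finset (Fin m → Fin 2)), F (List.ofFn l)
      ≤ ∑ α ∈ Finset.Nat.antidiagonalTuple 2 m, F (mIdxList α) := fun l _ => by
    have hp : (List.ofFn l).Perm (mIdxList fun i => (List.ofFn l).count i) :=
      List.perm_iff_count.2 fun i => (count_mIdxList (fun j => (List.ofFn l).count j) i).symm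
    rw [hperm _ _ hp]
    refine Finset.single_le_sum (f := fun α => F (mIdxList α)) (fun α _ => hF _) ?_
    rw [Finset.Nat.mem_antidiagonalTuple, ← length_eq_sum_count, List.length_ofFn]
  refine (Finset.sum_le_card_nsmul _ _ _ key).trans_eq ?_
  simp [nsmul_eq_mul]

variable {w : (Fin 2 → ℝ) → Fin 2 → ℝ}

theorem torusInt_gradSq (hw : ∀ i, SmoothPer fun y => w y i) (m : ℕ) :
    torusInt (gradSq m w) = ∑ i, ∑ α ∈ Finset.Nat.antidiagonalTuple 2 m,
      torusInt (fun x => pdList (mIdxList α) (fun y => w y i) x ^ 2) := by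
  unfold gradSq pdM
  rw [torusInt_sum _ fun α _ => (SmoothPer.sum _ fun i _ =>
      ((hw i).pdList (mIdxList α)).pow 2).continuous, Finset.sum_comm]
  exact Finset.sum_congr rfl fun α _ =>
    torusInt_sum _ fun i _ => (((hw i).pdList (mIdxList α)).pow 2).continuous

theorem torusInt_gradSq_nonneg (m : ℕ) : 0 ≤ torusInt (gradSq m w) :=
  torusInt_nonneg fun _ => Finset.sum_nonneg fun _ _ => Finset.sum_nonneg fun _ _ => sq_nonneg _

theorem torusInt_gradSq_le (hw : ∀ i, SmoothPer fun y => w y i) (m : ℕ) :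
    torusInt (gradSq m w) ≤ gradEnergy m fun i y => w y i := by
  rw [torusInt_gradSq hw]
  exact Finset.sum_le_sum fun i _ => sum_mIdxList_le m
    (F := fun l => torusInt (fun x => pdList l (fun y => w y i) x ^ 2))
    fun _ => torusInt_nonneg fun _ => sq_nonneg _

theorem gradEnergy_le (hw : ∀ i, SmoothPer fun y => w y i) (m : ℕ) :
    gradEnergy m (fun i y => w y i) ≤ 2 ^ m * torusInt (gradSq m w) := by
  rw [torusInt_gradSq hw, Finset.mul_sum]
  exact Finset.sum_le_sum fun i _ => sum_ofFn_le m
    (F := fun l => torusInt (fun x => pdList l (fun y => w y i) x ^ 2))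
    (fun _ => torusInt_nonneg fun _ => sq_nonneg _)
    fun l l' hl => by simp only [pdList_perm (hw i) hl]

theorem HnormSq_nonneg (r : ℕ) : 0 ≤ HnormSq 1 r w :=
  Finset.sum_nonneg fun _ _ => torusInt_gradSq_nonneg _

theorem HnormSq_le (hw : ∀ i, SmoothPer fun y => w y i) (r : ℕ) :
    HnormSq 1 r w ≤ ∑ m ∈ Finset.range (r + 1), gradEnergy m fun i y => w y i :=
  Finset.sum_le_sum fun m _ => torusInt_gradSq_le hw m

theorem gradEnergy_le_HnormSq (hw : ∀ i, SmoothPer fun y => w y i) (m : ℕ) :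
    gradEnergy m (fun i y => w y i) ≤ 2 ^ m * HnormSq 1 m w := by
  refine (gradEnergy_le hw m).trans (mul_le_mul_of_nonneg_left ?_ (by positivity))
  exact Finset.single_le_sum (f := fun k => torusInt (gradSq k w))
    (fun _ _ => torusInt_gradSq_nonneg _) (Finset.self_mem_range_succ m)

end MultiIndex

namespace IsMHD

variable {σ κ ν η : ℝ} {u b : ℝ → (Fin 2 → ℝ) → Fin 2 → ℝ} {P : ℝ → (Fin 2 → ℝ) → ℝ} {t : ℝ}

theorem HnormSq_add_le (h : IsMHD 2 1 ν η (Ici 0) u b P) (ht : 0 ≤ t) (r : ℕ) :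
    HnormSq 1 r (u t) + HnormSq 1 r (b t)
      ≤ ∑ m ∈ Finset.range (r + 1), gradEnergy m (mhdComps u b t) := by
  simp only [mhdComps, gradEnergy_sum_elim, Finset.sum_add_distrib]
  exact add_le_add (HnormSq_le (h.smoothPer_comps_u ht) r) (HnormSq_le (h.smoothPer_comps_b ht) r)

theorem energy_zero_le (h : IsMHD 2 1 ν η (Ici 0) u b P) :
    gradEnergy 0 (mhdComps u b 0) ≤ HnormSq 1 0 (u 0) + HnormSq 1 0 (b 0) := by
  have h1 := gradEnergy_le_HnormSq (h.smoothPer_comps_u le_rfl) 0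
  have h2 := gradEnergy_le_HnormSq (h.smoothPer_comps_b le_rfl) 0
  rw [pow_zero, one_mul] at h1 h2
  rw [mhdComps, gradEnergy_sum_elim]
  exact add_le_add h1 h2

theorem energy_initial_le (h : IsMHD 2 1 ν η (Ici 0) u b P) {C₁ N : ℝ} (hN : 1 < N) {r m : ℕ}
    (hm : m ≤ r) (hC : Hnorm 1 m (u 0) + Hnorm 1 m (b 0) ≤ C₁ * N ^ m) :
    gradEnergy m (mhdComps u b 0) ≤ 2 ^ r * C₁ ^ 2 * N ^ (2 * r) := by
  have h1 := gradEnergy_le_HnormSq (h.smoothPer_comps_u le_rfl) m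
  have h2 := gradEnergy_le_HnormSq (h.smoothPer_comps_b le_rfl) m
  have n1 : 0 ≤ Hnorm 1 m (u 0) := Real.sqrt_nonneg _
  have n2 : 0 ≤ Hnorm 1 m (b 0) := Real.sqrt_nonneg _
  have e1 : Hnorm 1 m (u 0) ^ 2 = HnormSq 1 m (u 0) := Real.sq_sqrt (HnormSq_nonneg m)
  have e2 : Hnorm 1 m (b 0) ^ 2 = HnormSq 1 m (b 0) := Real.sq_sqrt (HnormSq_nonneg m)
  have h3 : HnormSq 1 m (u 0) + HnormSq 1 m (b 0) ≤ (C₁ * N ^ m) ^ 2 := by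
    rw [← e1, ← e2]
    nlinarith [mul_nonneg n1 n2, pow_le_pow_left₀ (add_nonneg n1 n2) hC 2]
  calc gradEnergy m (mhdComps u b 0)
      ≤ 2 ^ m * (HnormSq 1 m (u 0) + HnormSq 1 m (b 0)) := by
        rw [mhdComps, gradEnergy_sum_elim, mul_add]
        exact add_le_add h1 h2
    _ ≤ 2 ^ m * (C₁ * N ^ m) ^ 2 := by gcongr
    _ = 2 ^ m * C₁ ^ 2 * N ^ (2 * m) := by rw [mul_pow, ← pow_mul, mul_comm m 2, mul_assoc]
    _ ≤ 2 ^ r * C₁ ^ 2 * N ^ (2 * r) := by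
      gcongr
      · norm_num
      · exact hN.le

theorem integral_gradSq_le (h : IsMHD 2 1 ν η (Ici 0) u b P) (hν : 0 < ν) (hη : 0 < η)
    (ht : 0 ≤ t) (m : ℕ) :
    ν * (∫ s in Ioc (0 : ℝ) t, torusInt (gradSq m (u s)))
        + η * (∫ s in Ioc (0 : ℝ) t, torusInt (gradSq m (b s)))
      ≤ ∫ s in (0 : ℝ)..t, dissipation ν η u b m s := by
  have hsub : uIcc 0 t ⊆ Ici 0 := by
    rw [uIcc_of_le ht]
    exact Icc_subset_Ici_self
  have iu := ((h.continuousOn_energy_u m).mono hsub).intervalIntegrable (μ := volume)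
  have ib := ((h.continuousOn_energy_b m).mono hsub).intervalIntegrable (μ := volume)
  have key : ∀ {w : ℝ → (Fin 2 → ℝ) → Fin 2 → ℝ},
      (∀ s, 0 ≤ s → ∀ i, SmoothPer (comps w s i)) →
      IntervalIntegrable (fun s => gradEnergy m (comps w s)) volume 0 t →
      (∫ s in Ioc (0 : ℝ) t, torusInt (gradSq m (w s)))
        ≤ ∫ s in (0 : ℝ)..t, gradEnergy m (comps w s) := fun {w} hw hi => by
    rw [intervalIntegral.integral_of_le ht]
    refine integral_mono_of_nonneg (Filter.Eventually.of_forall fun _ =>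
      torusInt_gradSq_nonneg _) ((intervalIntegrable_iff_integrableOn_Ioc_of_le ht).1 hi) ?_
    exact (ae_restrict_mem measurableSet_Ioc).mono fun s hs =>
      torusInt_gradSq_le (hw s hs.1.le) m
  unfold dissipation
  rw [intervalIntegral.integral_add (iu.const_mul ν) (ib.const_mul η),
    intervalIntegral.integral_const_mul, intervalIntegral.integral_const_mul]
  exact add_le_add
    (mul_le_mul_of_nonneg_left (key (fun s hs => h.smoothPer_comps_u hs) iu) hν.le)
    (mul_le_mul_of_nonneg_left (key (fun s hs => h.smoothPer_comps_b hs) ib) hη.le)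

end IsMHD

/-- boundedness of the `H^r` norms in 2D, Theorem 6.2 of the paper.
The constant `C` depends only on `σ`, `κ`, `r` and `C₁`. -/
theorem hr_bound_2d (σ κ C₁ : ℝ) (r : ℕ) (hσ : 0 < σ) (hκ0 : 0 < κ) (hκ2 : κ < 2) :
    ∃ C : ℝ, 0 < C ∧
    ∀ ν η N : ℝ, 0 < ν → 0 < η → σ < min ν η → 1 < N →
    ∀ (u b : ℝ → (Fin 2 → ℝ) → Fin 2 → ℝ) (P : ℝ → (Fin 2 → ℝ) → ℝ),
      IsMHD 2 1 ν η (Set.Ici 0) u b P →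
      ZeroAvg 1 (u 0) → ZeroAvg 1 (b 0) →
      (∀ j : ℕ, j ≤ r → Hnorm 1 j (u 0) + Hnorm 1 j (b 0) ≤ C₁ * N ^ j) →
      ∀ t : ℝ, 0 ≤ t →
        (HnormSq 1 r (u t) + HnormSq 1 r (b t)
            + κ * ν * (∫ s in Set.Ioc (0 : ℝ) t, ∫ x in box 2 1, gradSq (r + 1) (u s) x)
            + κ * η * (∫ s in Set.Ioc (0 : ℝ) t, ∫ x in box 2 1, gradSq (r + 1) (b s) x)
          ≤ N ^ (2 * r)
            * Real.exp (C * (1 + HnormSq 1 0 (u 0) + HnormSq 1 0 (b 0)) / σ ^ 2)) ∧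
        (HnormSq 1 r (u t) + HnormSq 1 r (b t)
          ≤ N ^ (2 * r) * Real.exp (-(2 * σ) * t)
            * Real.exp (C * (1 + HnormSq 1 0 (u 0) + HnormSq 1 0 (b 0)) / σ ^ 2)) := by
  have hκ' : 0 < 2 - κ := by linarith
  set A : ℝ := ∑ m ∈ Finset.range (r + 1),
    (energyConst m ^ 2 / (2 * (2 - κ)) + energyConst m ^ 2 / 2) with hA
  have hA0 : 0 ≤ A := Finset.sum_nonneg fun m _ => by positivity
  have hAm : ∀ m ∈ Finset.range (r + 1),
      energyConst m ^ 2 / (2 * (2 - κ)) + energyConst m ^ 2 / 2 ≤ A := fun m hm =>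
    Finset.single_le_sum
      (f := fun m => energyConst m ^ 2 / (2 * (2 - κ)) + energyConst m ^ 2 / 2)
      (fun m _ => by positivity) hm
  set B : ℝ := (r + 1) * (2 ^ r * C₁ ^ 2) with hB
  have hB0 : 0 ≤ B := by positivity
  refine ⟨A + B * σ ^ 2 + 1, by positivity, ?_⟩
  intro ν η N hν hη hσm hN u b P h hu hb hC t ht
  set E₀ := gradEnergy 0 (mhdComps u b 0) with hE₀
  have hE₀0 : 0 ≤ E₀ := gradEnergy_nonneg _ _
  have hΓ := h.energy_zero_le
  rw [← hE₀] at hΓ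
  have hexp : B * exp (A * E₀ / σ ^ 2) ≤ exp ((A + B * σ ^ 2 + 1)
      * (1 + HnormSq 1 0 (u 0) + HnormSq 1 0 (b 0)) / σ ^ 2) := by
    have h1 : B ≤ exp B := by linarith [add_one_le_exp B]
    refine (mul_le_mul_of_nonneg_right h1 (exp_pos _).le).trans ?_
    rw [← exp_add, exp_le_exp, le_div_iff₀ (by positivity), add_mul, div_mul_cancel₀ _ (by positivity)]
    have h2 : (A + B * σ ^ 2 + 1) * (1 + E₀) ≤ (A + B * σ ^ 2 + 1)
        * (1 + HnormSq 1 0 (u 0) + HnormSq 1 0 (b 0)) :=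
      mul_le_mul_of_nonneg_left (by linarith) (by positivity)
    have h3 : 0 ≤ B * σ ^ 2 * E₀ := by positivity
    nlinarith
  have hinit : ∀ m ∈ Finset.range (r + 1),
      gradEnergy m (mhdComps u b 0) ≤ 2 ^ r * C₁ ^ 2 * N ^ (2 * r) := fun m hm =>
    h.energy_initial_le hN (Finset.mem_range_succ_iff.1 hm) (hC m (Finset.mem_range_succ_iff.1 hm))
  have hN0 : 0 < N := by linarith
  have hsum : ∀ {F : ℕ → ℝ} {X : ℝ}, 0 ≤ X →
      (∀ m ∈ Finset.range (r + 1), F m ≤ gradEnergy m (mhdComps u b 0) * X * exp (A * E₀ / σ ^ 2)) →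
      ∑ m ∈ Finset.range (r + 1), F m ≤ N ^ (2 * r) * X * exp ((A + B * σ ^ 2 + 1)
        * (1 + HnormSq 1 0 (u 0) + HnormSq 1 0 (b 0)) / σ ^ 2) := fun {F X} hX hF => by
    have h1 : ∀ m ∈ Finset.range (r + 1),
        F m ≤ 2 ^ r * C₁ ^ 2 * N ^ (2 * r) * X * exp (A * E₀ / σ ^ 2) := fun m hm =>
      (hF m hm).trans (by have := hinit m hm; gcongr)
    refine (Finset.sum_le_card_nsmul _ _ _ h1).trans ?_
    rw [Finset.card_range, nsmul_eq_mul]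
    push_cast
    calc ((r : ℝ) + 1) * (2 ^ r * C₁ ^ 2 * N ^ (2 * r) * X * exp (A * E₀ / σ ^ 2))
        = N ^ (2 * r) * X * (B * exp (A * E₀ / σ ^ 2)) := by rw [hB]; ring
      _ ≤ _ := by gcongr
  have hle₁ : ∀ m ∈ Finset.range (r + 1), energyConst m ^ 2 / (2 * (2 - κ)) ≤ A := fun m hm =>
    (le_add_of_nonneg_right (by positivity)).trans (hAm m hm)
  have hle₂ : ∀ m ∈ Finset.range (r + 1), energyConst m ^ 2 / 2 ≤ A := fun m hm =>
    (le_add_of_nonneg_left (by positivity)).trans (hAm m hm)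
  constructor
  · have hdiss := mul_le_mul_of_nonneg_left (h.integral_gradSq_le hν hη ht (r + 1)) hκ0.le
    have hterm : ∀ m ∈ Finset.range (r + 1), gradEnergy m (mhdComps u b t)
        + (if m = r then κ * ∫ s in (0 : ℝ)..t, dissipation ν η u b (r + 1) s else 0)
        ≤ gradEnergy m (mhdComps u b 0) * 1 * exp (A * E₀ / σ ^ 2) := fun m hm => by
      have h1 := h.energy_add_dissipation_le hσ hσm hκ0 hκ2 m ht
      have h2 : 0 ≤ κ * ∫ s in (0 : ℝ)..t, dissipation ν η u b (m + 1) s :=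
        mul_nonneg hκ0.le (intervalIntegral.integral_nonneg ht fun s _ =>
          IsMHD.dissipation_nonneg hν hη _)
      have h3 : gradEnergy m (mhdComps u b 0) * exp (energyConst m ^ 2 / (2 * (2 - κ)) * E₀ / σ ^ 2)
          ≤ gradEnergy m (mhdComps u b 0) * 1 * exp (A * E₀ / σ ^ 2) := by
        have := hle₁ m hm
        have := gradEnergy_nonneg m (mhdComps u b 0)
        rw [mul_one]
        gcongr
      split_ifs with hmr
      · subst hmr
        linarith
      · linarith
    have hfin := hsum zero_le_one hterm
    rw [Finset.sum_add_distrib, Finset.sum_ite_eq' , if_pos (Finset.self_mem_range_succ r),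
      mul_one] at hfin
    have hH := h.HnormSq_add_le ht r
    simp only [torusInt] at hdiss
    linarith
  · refine (h.HnormSq_add_le ht r).trans (hsum (exp_pos _).le fun m hm => ?_)
    refine (h.energy_le_exp_neg hu hb hσ hσm m ht).trans ?_
    have := hle₂ m hm
    have := gradEnergy_nonneg m (mhdComps u b 0)
    gcongr

end
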